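/- Let H be the Hamiltonian of form (4), fix a > 0, g ∈ ℝ, and let h ∈ ℝ be such that at every point y ∈ M⁴_{a,g} with H(y) = h the differentials of H, F₁ = ⟨R,R⟩ and F₂ = ⟨S,R⟩ are linearly independent. Then the isoenergy surface Q = {(S,R) ∈ ℝ⁶ : ⟨R,R⟩ = a, ⟨S,R⟩ = g, H(S,R) = h}, with the subspace topology, is homeomorphic either to the real projective space ℝP³, or to a disjoint union of finitely many copies of S¹ × S² together with at most two copies of the 3-sphere S³. -/

import Mathlib

noncomputable section

/-- ℝ⁶ with coordinates (S₁,S₂,S₃,R₁,R₂,R₃). -/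
abbrev E6 := Fin 6 → ℝ

/-- Partial derivative of `f` at `y` in the `i`-th coordinate direction. -/
def pd (f : E6 → ℝ) (y : E6) (i : Fin 6) : ℝ := fderiv ℝ f y (Pi.single i 1)

/-- Cross product in ℝ³. -/
def cross (u v : Fin 3 → ℝ) : Fin 3 → ℝ :=
  ![u 1 * v 2 - u 2 * v 1, u 2 * v 0 - u 0 * v 2, u 0 * v 1 - u 1 * v 0]

/-- Euclidean inner product in ℝ³. -/
def dot (u v : Fin 3 → ℝ) : ℝ := u 0 * v 0 + u 1 * v 1 + u 2 * v 2

/-- Assemble a point of ℝ⁶ from S- and R-blocks. -/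
def pt (S R : Fin 3 → ℝ) : E6 := ![S 0, S 1, S 2, R 0, R 1, R 2]

/-- S-block of a point of ℝ⁶. -/
def Sv (y : E6) : Fin 3 → ℝ := ![y 0, y 1, y 2]

/-- R-block of a point of ℝ⁶. -/
def Rv (y : E6) : Fin 3 → ℝ := ![y 3, y 4, y 5]

/-- The Hamiltonian vector field (skew gradient)
`sgrad f = (∂f/∂S × S + ∂f/∂R × R, ∂f/∂S × R)`. -/
def sgrad (f : E6 → ℝ) (y : E6) : E6 :=
  pt (cross ![pd f y 0, pd f y 1, pd f y 2] (Sv y)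
        + cross ![pd f y 3, pd f y 4, pd f y 5] (Rv y))
     (cross ![pd f y 0, pd f y 1, pd f y 2] (Rv y))

/-- The Lie–Poisson bracket for e(3)*:
`{f,g}(S,R) = ⟨S, f_S × g_S⟩ + ⟨R, f_S × g_R⟩ + ⟨R, f_R × g_S⟩`. -/
def bracket (f g : E6 → ℝ) (y : E6) : ℝ :=
  dot (Sv y) (cross ![pd f y 0, pd f y 1, pd f y 2] ![pd g y 0, pd g y 1, pd g y 2])
  + dot (Rv y) (cross ![pd f y 0, pd f y 1, pd f y 2] ![pd g y 3, pd g y 4, pd g y 5])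
  + dot (Rv y) (cross ![pd f y 3, pd f y 4, pd f y 5] ![pd g y 0, pd g y 1, pd g y 2])

/-- The Hamiltonian of form (4). -/
def H4 (β : ℝ) (g₁ g₂ g₃ V : ℝ → ℝ → ℝ) (y : E6) : ℝ :=
  (1/2) * ((y 0)^2 + (y 1)^2 + (y 2)^2 / β)
  + g₁ ((y 3)^2 + (y 4)^2 + (y 5)^2) (y 5) * (y 0 * y 4 - y 1 * y 3)
  + g₂ ((y 3)^2 + (y 4)^2 + (y 5)^2) (y 5) * (y 0 * y 3 + y 1 * y 4 + y 2 * y 5)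
  + g₃ ((y 3)^2 + (y 4)^2 + (y 5)^2) (y 5) * y 2
  + V ((y 3)^2 + (y 4)^2 + (y 5)^2) (y 5)

/-- The reduced potential `W_{a,g}(k,x)`. -/
def W (β : ℝ) (g₁ g₂ g₃ V : ℝ → ℝ → ℝ) (a g k x : ℝ) : ℝ :=
  (g - k*x)^2 / (2*(a - x^2)) + k^2/(2*β) - (g₁ a x)^2 * (a - x^2)/2
  + g₂ a x * g + g₃ a x * k + V a x


/-- The unit sphere Sⁿ ⊂ ℝⁿ⁺¹. -/
abbrev sphereS (n : ℕ) := Metric.sphere (0 : EuclideanSpace ℝ (Fin (n+1))) 1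

/-- The antipodal equivalence relation on S³. -/
def antipodal : Setoid (sphereS 3) where
  r x y := (x : EuclideanSpace ℝ (Fin 4)) = (y : EuclideanSpace ℝ (Fin 4)) ∨
    (x : EuclideanSpace ℝ (Fin 4)) = -(y : EuclideanSpace ℝ (Fin 4))
  iseqv := by
    constructor
    · intro x; exact Or.inl rfl
    · intro x y hxy
      rcases hxy with h | h
      · exact Or.inl h.symm
      · exact Or.inr (by rw [h, neg_neg])
    · intro x y z hxy hyz
      rcases hxy with h | h <;> rcases hyz with h' | h'
      · exact Or.inl (h.trans h')
      · exact Or.inr (h.trans h')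
      · exact Or.inr (by rw [h, h'])
      · exact Or.inl (by rw [h, h', neg_neg])

/-- Real projective 3-space as the quotient of S³ by the antipodal map. -/
def RP3 : Type := Quotient antipodal

instance : TopologicalSpace RP3 :=
  instTopologicalSpaceQuotient

section

open Set Filter Topology

/-- Homeomorphism between subsets from mutually inverse maps. -/
def iso_mk {A B : Type*} [TopologicalSpace A] [TopologicalSpace B] (s : Set A) (t : Set B)
    (f : A → B) (k : B → A) (hf : ContinuousOn f s) (hk : ContinuousOn k t)
    (hst : ∀ x ∈ s, f x ∈ t) (hts : ∀ y ∈ t, k y ∈ s)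
    (hl : ∀ x ∈ s, k (f x) = x) (hr : ∀ y ∈ t, f (k y) = y) : s ≃ₜ t where
  toFun x := ⟨f x, hst x x.2⟩
  invFun y := ⟨k y, hts y y.2⟩
  left_inv x := Subtype.ext (hl x x.2)
  right_inv y := Subtype.ext (hr y y.2)
  continuous_toFun := (continuousOn_iff_continuous_domRestrict.1 hf).subtype_mk _
  continuous_invFun := (continuousOn_iff_continuous_domRestrict.1 hk).subtype_mk _

/-- Splitting a set along a level that is not attained. -/
theorem iso_split {A : Type*} [TopologicalSpace A] (s t u : Set A) (f : A → ℝ)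
    (hf : Continuous f) (c : ℝ) (hc : ∀ x ∈ s, f x ≠ c)
    (ht : ∀ x, x ∈ t ↔ x ∈ s ∧ f x ≤ c) (hu : ∀ x, x ∈ u ↔ x ∈ s ∧ c ≤ f x) :
    Nonempty (s ≃ₜ (t ⊕ u)) := by
  let F : t ⊕ u → s := Sum.elim (fun x => ⟨x, ((ht x).1 x.2).1⟩) (fun x => ⟨x, ((hu x).1 x.2).1⟩)
  have hFc : Continuous F := by
    apply Continuous.sumElim
    · exact continuous_subtype_val.subtype_mk _
    · exact continuous_subtype_val.subtype_mk _
  have hb : Function.Bijective F := by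
    constructor
    · rintro (x | x) (y | y) hxy
      · have := congrArg Subtype.val hxy
        simp only [F, Sum.elim_inl] at this
        rw [Subtype.ext this]
      · have := congrArg Subtype.val hxy
        simp only [F, Sum.elim_inl, Sum.elim_inr] at this
        exfalso
        have h1 := (ht x).1 x.2
        have h2 := (hu y).1 y.2
        rw [← this] at h2
        exact hc _ h1.1 (le_antisymm h1.2 h2.2)
      · have := congrArg Subtype.val hxy
        simp only [F, Sum.elim_inl, Sum.elim_inr] at this
        exfalso
        have h1 := (hu x).1 x.2
        have h2 := (ht y).1 y.2
        rw [← this] at h2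
        exact hc _ h1.1 (le_antisymm h2.2 h1.2)
      · have := congrArg Subtype.val hxy
        simp only [F, Sum.elim_inr] at this
        rw [Subtype.ext this]
    · rintro ⟨x, hx⟩
      rcases le_total (f x) c with h | h
      · exact ⟨Sum.inl ⟨x, (ht x).2 ⟨hx, h⟩⟩, rfl⟩
      · exact ⟨Sum.inr ⟨x, (hu x).2 ⟨hx, h⟩⟩, rfl⟩
  have ho : IsOpenMap F := by
    apply IsOpenMap.sumElim
    · have : Topology.IsOpenEmbedding (fun x : t => (⟨x, ((ht x).1 x.2).1⟩ : s)) := by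
        refine ⟨⟨?_, ?_⟩, ?_⟩
        · exact (Topology.IsInducing.of_comp (g := Subtype.val)
            (continuous_subtype_val.subtype_mk _) continuous_subtype_val
            Topology.IsInducing.subtypeVal)
        · intro x y h
          exact Subtype.ext (congrArg (fun z : s => (z : A)) h)
        · have : range (fun x : t => (⟨x, ((ht x).1 x.2).1⟩ : s)) = {x : s | f x < c} := by
            ext ⟨x, hx⟩
            simp only [mem_range, mem_ofPred_eq, Subtype.mk.injEq]
            constructor
            · rintro ⟨y, rfl⟩
              exact lt_of_le_of_ne ((ht _).1 y.2).2 (hc _ hx)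
            · intro h
              exact ⟨⟨x, (ht x).2 ⟨hx, h.le⟩⟩, rfl⟩
          rw [this]
          exact isOpen_lt (hf.comp continuous_subtype_val) continuous_const
      exact this.isOpenMap
    · have : Topology.IsOpenEmbedding (fun x : u => (⟨x, ((hu x).1 x.2).1⟩ : s)) := by
        refine ⟨⟨?_, ?_⟩, ?_⟩
        · exact (Topology.IsInducing.of_comp (g := Subtype.val)
            (continuous_subtype_val.subtype_mk _) continuous_subtype_val
            Topology.IsInducing.subtypeVal)
        · intro x y h
          exact Subtype.ext (congrArg (fun z : s => (z : A)) h)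
        · have : range (fun x : u => (⟨x, ((hu x).1 x.2).1⟩ : s)) = {x : s | c < f x} := by
            ext ⟨x, hx⟩
            simp only [mem_range, mem_ofPred_eq, Subtype.mk.injEq]
            constructor
            · rintro ⟨y, rfl⟩
              exact lt_of_le_of_ne ((hu _).1 y.2).2 (Ne.symm (hc _ hx))
            · intro h
              exact ⟨⟨x, (hu x).2 ⟨hx, h.le⟩⟩, rfl⟩
          rw [this]
          exact isOpen_lt continuous_const (hf.comp continuous_subtype_val)
      exact this.isOpenMap
  exact ⟨((Equiv.ofBijective F hb).toHomeomorphOfContinuousOpen hFc ho).symm⟩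

/-- Finite disjoint union with `n` copies of S¹ × S² and at most `m` copies of S³. -/
def iso_good (T : Type) [TopologicalSpace T] (m : ℕ) : Prop :=
  ∃ n k : ℕ, k ≤ m ∧
    Nonempty (T ≃ₜ ((Σ _ : Fin n, sphereS 1 × sphereS 2) ⊕ (Σ _ : Fin k, sphereS 3)))

def iso_sigma_add (A : Type) [TopologicalSpace A] (n m : ℕ) :
    ((Σ _ : Fin n, A) ⊕ (Σ _ : Fin m, A)) ≃ₜ (Σ _ : Fin (n + m), A) where
  toFun := Sum.elim (fun x => ⟨Fin.castAdd m x.1, x.2⟩) (fun x => ⟨Fin.natAdd n x.1, x.2⟩)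
  invFun x := Fin.addCases (motive := fun _ => (Σ _ : Fin n, A) ⊕ (Σ _ : Fin m, A))
    (fun i => Sum.inl ⟨i, x.2⟩) (fun i => Sum.inr ⟨i, x.2⟩) x.1
  left_inv := by
    rintro (⟨i, x⟩ | ⟨i, x⟩) <;> simp
  right_inv := by
    rintro ⟨i, x⟩
    refine Fin.addCases (fun i => ?_) (fun i => ?_) i <;> simp
  continuous_toFun := by
    apply Continuous.sumElim
    · exact continuous_sigma fun i => continuous_sigmaMk (σ := fun _ : Fin (n+m) => A)
        (i := Fin.castAdd m i)
    · exact continuous_sigma fun i => continuous_sigmaMk (σ := fun _ : Fin (n+m) => A)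
        (i := Fin.natAdd n i)
  continuous_invFun := by
    refine continuous_sigma fun i => ?_
    refine Fin.addCases (fun i => ?_) (fun i => ?_) i
    · simp only [Fin.addCases_left]
      exact continuous_inl.comp (continuous_sigmaMk (σ := fun _ : Fin n => A))
    · simp only [Fin.addCases_right]
      exact continuous_inr.comp (continuous_sigmaMk (σ := fun _ : Fin m => A))

theorem iso_good_add {T A B : Type} [TopologicalSpace T] [TopologicalSpace A] [TopologicalSpace B]
    {m k : ℕ} (e : Nonempty (T ≃ₜ (A ⊕ B))) (hA : iso_good A m) (hB : iso_good B k) :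
    iso_good T (m + k) := by
  obtain ⟨e⟩ := e
  obtain ⟨n1, m1, h1, ⟨e1⟩⟩ := hA
  obtain ⟨n2, m2, h2, ⟨e2⟩⟩ := hB
  refine ⟨n1 + n2, m1 + m2, by omega, ⟨?_⟩⟩
  exact (e.trans (e1.sumCongr e2)).trans
    ((Homeomorph.sumSumSumComm _ _ _ _).trans
      ((iso_sigma_add _ n1 n2).sumCongr (iso_sigma_add _ m1 m2)))

theorem iso_good_empty {T : Type} [TopologicalSpace T] [IsEmpty T] : iso_good T 0 :=
  ⟨0, 0, le_rfl, ⟨Homeomorph.empty⟩⟩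

def iso_sigma_one (A : Type) [TopologicalSpace A] : A ≃ₜ (Σ _ : Fin 1, A) where
  toFun x := ⟨0, x⟩
  invFun x := x.2
  left_inv _ := rfl
  right_inv := by
    rintro ⟨i, x⟩
    obtain rfl : i = 0 := Subsingleton.elim _ _
    rfl
  continuous_toFun := continuous_sigmaMk (σ := fun _ : Fin 1 => A)
  continuous_invFun := continuous_sigma fun _ => continuous_id

theorem iso_good_S12 {T : Type} [TopologicalSpace T] (e : Nonempty (T ≃ₜ sphereS 1 × sphereS 2)) :
    iso_good T 0 := by
  obtain ⟨e⟩ := e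
  exact ⟨1, 0, le_rfl, ⟨(e.trans (iso_sigma_one _)).trans (Homeomorph.sumEmpty _ _).symm⟩⟩

theorem iso_good_S3 {T : Type} [TopologicalSpace T] (e : Nonempty (T ≃ₜ sphereS 3)) :
    iso_good T 1 := by
  obtain ⟨e⟩ := e
  exact ⟨0, 1, le_rfl, ⟨(e.trans (iso_sigma_one _)).trans (Homeomorph.emptySum _ _).symm⟩⟩

theorem iso_good_congr {T T' : Type} [TopologicalSpace T] [TopologicalSpace T'] {m : ℕ}
    (e : T ≃ₜ T') (h : iso_good T' m) : iso_good T m := by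
  obtain ⟨n1, m1, h1, ⟨e1⟩⟩ := h
  exact ⟨n1, m1, h1, ⟨e.trans e1⟩⟩


/-- The model: pairs (n,U), n unit, U tangent at n, |U|² = ρ(n₃), p ≤ n₃ ≤ q. -/
def isoX (ρ : ℝ → ℝ) (p q : ℝ) : Set (ℝ × ℝ × ℝ × ℝ × ℝ × ℝ) :=
  {w | (w.1 ^ 2 + w.2.1 ^ 2 + w.2.2.1 ^ 2 = 1) ∧ (p ≤ w.2.2.1 ∧ w.2.2.1 ≤ q) ∧
    (w.1 * w.2.2.2.1 + w.2.1 * w.2.2.2.2.1 + w.2.2.1 * w.2.2.2.2.2 = 0) ∧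
    (w.2.2.2.1 ^ 2 + w.2.2.2.2.1 ^ 2 + w.2.2.2.2.2 ^ 2 = ρ w.2.2.1)}

/-- The trivialised model. -/
def isoY (α ρ : ℝ → ℝ) (p q : ℝ) : Set (ℝ × ℝ × ℝ × ℝ × ℝ) :=
  {w | (p ≤ w.2.2.1 ∧ w.2.2.1 ≤ q) ∧ (w.1 ^ 2 + w.2.1 ^ 2 = α w.2.2.1) ∧
    (w.2.2.2.1 ^ 2 + w.2.2.2.2 ^ 2 = ρ w.2.2.1)}

theorem isoX_mem (ρ : ℝ → ℝ) (p q a b c u v w : ℝ) : (a, b, c, u, v, w) ∈ isoX ρ p q ↔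
    (a ^ 2 + b ^ 2 + c ^ 2 = 1) ∧ (p ≤ c ∧ c ≤ q) ∧ (a * u + b * v + c * w = 0) ∧
    (u ^ 2 + v ^ 2 + w ^ 2 = ρ c) := Iff.rfl

theorem isoY_mem (α ρ : ℝ → ℝ) (p q a b c u v : ℝ) : (a, b, c, u, v) ∈ isoY α ρ p q ↔
    (p ≤ c ∧ c ≤ q) ∧ (a ^ 2 + b ^ 2 = α c) ∧ (u ^ 2 + v ^ 2 = ρ c) := Iff.rfl

theorem isoX_frame (ρ : ℝ → ℝ) (p q : ℝ) (hq : q < 1) :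
    Nonempty (isoX ρ p q ≃ₜ isoY (fun z => 1 - z ^ 2) ρ p q) := by
  refine ⟨iso_mk _ _
    (fun w => (w.1, w.2.1, w.2.2.1, w.2.2.2.1 + w.1 * w.2.2.2.2.2 / (1 - w.2.2.1),
      w.2.2.2.2.1 + w.2.1 * w.2.2.2.2.2 / (1 - w.2.2.1)))
    (fun w => (w.1, w.2.1, w.2.2.1,
      w.2.2.2.1 - w.1 * (w.1 * w.2.2.2.1 + w.2.1 * w.2.2.2.2) / (1 - w.2.2.1),
      w.2.2.2.2 - w.2.1 * (w.1 * w.2.2.2.1 + w.2.1 * w.2.2.2.2) / (1 - w.2.2.1),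
      w.1 * w.2.2.2.1 + w.2.1 * w.2.2.2.2)) ?_ ?_ ?_ ?_ ?_ ?_⟩
  · have h0 : ∀ w ∈ isoX ρ p q, 1 - w.2.2.1 ≠ 0 := by
      intro w hw
      have := hw.2.1.2
      linarith
    fun_prop (disch := assumption)
  · have h0 : ∀ w ∈ isoY (fun z => 1 - z ^ 2) ρ p q, 1 - w.2.2.1 ≠ 0 := by
      intro w hw
      have := hw.1.2
      linarith
    fun_prop (disch := assumption)
  · rintro ⟨a, b, c, u, v, w⟩ h
    rw [isoX_mem] at h
    obtain ⟨h1, h2, h3, h4⟩ := h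
    have hc : 1 - c ≠ 0 := by linarith
    rw [isoY_mem]
    refine ⟨h2, by linarith, ?_⟩
    rw [← h4]
    have hab : a ^ 2 + b ^ 2 = (1 - c) * (1 + c) := by linarith
    have : (u + a * w / (1 - c)) ^ 2 + (v + b * w / (1 - c)) ^ 2
      = u ^ 2 + v ^ 2 + 2 * (a * u + b * v) * w / (1 - c)
        + (a ^ 2 + b ^ 2) * w ^ 2 / (1 - c) ^ 2 := by field_simp; ring
    rw [this, hab, show a * u + b * v = - c * w by linarith]
    field_simp
    ring
  · rintro ⟨a, b, c, u, v⟩ h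
    rw [isoY_mem] at h
    obtain ⟨h2, h1, h4⟩ := h
    have hc : 1 - c ≠ 0 := by linarith
    rw [isoX_mem]
    refine ⟨by linarith, h2, ?_, ?_⟩
    · have : a * (u - a * (a * u + b * v) / (1 - c)) + b * (v - b * (a * u + b * v) / (1 - c)) +
        c * (a * u + b * v) = (a * u + b * v) * (1 + c - (a ^ 2 + b ^ 2) / (1 - c)) := by
        field_simp; ring
      rw [this, h1]
      field_simp
      ring
    · rw [← h4]
      generalize ht : a * u + b * v = t
      have : (u - a * t / (1 - c)) ^ 2 + (v - b * t / (1 - c)) ^ 2 + t ^ 2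
        = u ^ 2 + v ^ 2 - 2 * (a * u + b * v) * t / (1 - c)
          + (a ^ 2 + b ^ 2) * t ^ 2 / (1 - c) ^ 2 + t ^ 2 := by field_simp; ring
      rw [this, h1, ht]
      field_simp
      ring
  · rintro ⟨a, b, c, u, v, w⟩ h
    rw [isoX_mem] at h
    obtain ⟨h1, h2, h3, h4⟩ := h
    have hc : 1 - c ≠ 0 := by linarith
    have hab : a ^ 2 + b ^ 2 = (1 - c) * (1 + c) := by linarith
    have : a * (u + a * w / (1 - c)) + b * (v + b * w / (1 - c)) = w := by
      have : a * (u + a * w / (1 - c)) + b * (v + b * w / (1 - c)) =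
        (a * u + b * v) + (a ^ 2 + b ^ 2) * w / (1 - c) := by field_simp; ring
      rw [this, hab, show a * u + b * v = - c * w by linarith]
      field_simp
      ring
    simp only [this, Prod.mk.injEq, true_and]
    refine ⟨by ring, by ring, trivial⟩
  · rintro ⟨a, b, c, u, v⟩ h
    simp only [Prod.mk.injEq, true_and]
    refine ⟨by ring, by ring⟩

theorem isoX_reflect (ρ : ℝ → ℝ) (p q : ℝ) :
    Nonempty (isoX ρ p q ≃ₜ isoX (fun z => ρ (-z)) (-q) (-p)) := by
  refine ⟨iso_mk _ _
    (fun w => (w.1, w.2.1, -w.2.2.1, w.2.2.2.1, w.2.2.2.2.1, -w.2.2.2.2.2))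
    (fun w => (w.1, w.2.1, -w.2.2.1, w.2.2.2.1, w.2.2.2.2.1, -w.2.2.2.2.2))
    (by fun_prop) (by fun_prop) ?_ ?_ ?_ ?_⟩
  · rintro ⟨a, b, c, u, v, w⟩ h
    rw [isoX_mem] at h
    rw [isoX_mem]
    obtain ⟨h1, h2, h3, h4⟩ := h
    refine ⟨by linarith, ⟨by linarith, by linarith⟩, by linarith, ?_⟩
    simp only [neg_neg]; linarith
  · rintro ⟨a, b, c, u, v, w⟩ h
    rw [isoX_mem] at h
    rw [isoX_mem]
    obtain ⟨h1, h2, h3, h4⟩ := h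
    refine ⟨by linarith, ⟨by linarith, by linarith⟩, by linarith, ?_⟩
    linarith
  · rintro ⟨a, b, c, u, v, w⟩ h
    simp
  · rintro ⟨a, b, c, u, v, w⟩ h
    simp

theorem iso_scale_cont {A : Type*} [TopologicalSpace A] (K : Set A) (f s t : A → ℝ)
    (hf : ContinuousOn f K) (hs : ContinuousOn s K) (ht : ContinuousOn t K)
    (hfs : ∀ x ∈ K, f x ^ 2 ≤ s x) (ht0 : ∀ x ∈ K, 0 ≤ t x) (hst : ∀ x ∈ K, s x = 0 → t x = 0) :
    ContinuousOn (fun x => √(t x / s x) * f x) K := by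
  intro x hx
  by_cases h : s x = 0
  · have h0 : √(t x / s x) * f x = 0 := by simp [h]
    show Tendsto _ _ (𝓝 (√(t x / s x) * f x))
    rw [h0]
    have hlim : Tendsto (fun y => √(t y)) (𝓝[K] x) (𝓝 0) := by
      have := (ht x hx).sqrt
      change Tendsto _ _ (𝓝 (√(t x))) at this
      rwa [hst x hx h, Real.sqrt_zero] at this
    apply squeeze_zero_norm' _ hlim
    filter_upwards [self_mem_nhdsWithin] with y hy
    have hsy : 0 ≤ s y := le_trans (sq_nonneg _) (hfs y hy)
    rw [Real.norm_eq_abs, abs_mul, abs_of_nonneg (Real.sqrt_nonneg _)]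
    have hfa : |f y| ≤ √(s y) := Real.abs_le_sqrt (hfs y hy)
    calc √(t y / s y) * |f y| ≤ √(t y / s y) * √(s y) := by gcongr
      _ = √(t y / s y * s y) := (Real.sqrt_mul (div_nonneg (ht0 y hy) hsy) _).symm
      _ ≤ √(t y) := by
        apply Real.sqrt_le_sqrt
        by_cases h' : s y = 0
        · simp [h', ht0 y hy]
        · rw [div_mul_cancel₀ _ h']
  · exact (((ht x hx).div (hs x hx) h).sqrt).mul (hf x hx)

theorem iso_sqrt_cancel {s t x : ℝ} (hs : 0 ≤ s) (ht : 0 ≤ t) (hst : t = 0 → s = 0)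
    (hx : x ^ 2 ≤ s) : √(s / t) * (√(t / s) * x) = x := by
  by_cases h : s = 0
  · have : x = 0 := by
      rw [h] at hx
      exact pow_eq_zero_iff (two_ne_zero) |>.1 (le_antisymm hx (sq_nonneg _))
    simp [this]
  · have ht' : t ≠ 0 := fun h' => h (hst h')
    rw [← mul_assoc, ← Real.sqrt_mul (div_nonneg hs ht), show s / t * (t / s) = 1 by field_simp]
    simp

theorem isoY_rescale_aux (α ρ α' ρ' : ℝ → ℝ) (p q : ℝ)
    (hα : ∀ z ∈ Icc p q, 0 ≤ α z) (hα' : ∀ z ∈ Icc p q, 0 ≤ α' z)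
    (hρ : ∀ z ∈ Icc p q, 0 ≤ ρ z) (hρ' : ∀ z ∈ Icc p q, 0 ≤ ρ' z)
    (h1 : ∀ z ∈ Icc p q, α z = 0 → α' z = 0)
    (h3 : ∀ z ∈ Icc p q, ρ z = 0 → ρ' z = 0)
    (cα : ContinuousOn α (Icc p q)) (cα' : ContinuousOn α' (Icc p q))
    (cρ : ContinuousOn ρ (Icc p q)) (cρ' : ContinuousOn ρ' (Icc p q)) :
    ContinuousOn (fun w : ℝ × ℝ × ℝ × ℝ × ℝ =>
      (√(α' w.2.2.1 / α w.2.2.1) * w.1, √(α' w.2.2.1 / α w.2.2.1) * w.2.1, w.2.2.1,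
       √(ρ' w.2.2.1 / ρ w.2.2.1) * w.2.2.2.1, √(ρ' w.2.2.1 / ρ w.2.2.1) * w.2.2.2.2))
      (isoY α ρ p q) ∧
    ∀ w ∈ isoY α ρ p q,
      (√(α' w.2.2.1 / α w.2.2.1) * w.1, √(α' w.2.2.1 / α w.2.2.1) * w.2.1, w.2.2.1,
       √(ρ' w.2.2.1 / ρ w.2.2.1) * w.2.2.2.1, √(ρ' w.2.2.1 / ρ w.2.2.1) * w.2.2.2.2) ∈
      isoY α' ρ' p q := by
  have hm : MapsTo (fun w : ℝ × ℝ × ℝ × ℝ × ℝ => w.2.2.1) (isoY α ρ p q) (Icc p q) :=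
    fun w hw => hw.1
  have cz : ContinuousOn (fun w : ℝ × ℝ × ℝ × ℝ × ℝ => w.2.2.1) (isoY α ρ p q) := by fun_prop
  have kα : ContinuousOn (fun w : ℝ × ℝ × ℝ × ℝ × ℝ => α w.2.2.1) (isoY α ρ p q) :=
    ContinuousOn.comp (g := α) (f := fun w : ℝ × ℝ × ℝ × ℝ × ℝ => w.2.2.1) cα cz hm
  have kα' : ContinuousOn (fun w : ℝ × ℝ × ℝ × ℝ × ℝ => α' w.2.2.1) (isoY α ρ p q) :=
    ContinuousOn.comp (g := α') (f := fun w : ℝ × ℝ × ℝ × ℝ × ℝ => w.2.2.1) cα' cz hm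
  have kρ : ContinuousOn (fun w : ℝ × ℝ × ℝ × ℝ × ℝ => ρ w.2.2.1) (isoY α ρ p q) :=
    ContinuousOn.comp (g := ρ) (f := fun w : ℝ × ℝ × ℝ × ℝ × ℝ => w.2.2.1) cρ cz hm
  have kρ' : ContinuousOn (fun w : ℝ × ℝ × ℝ × ℝ × ℝ => ρ' w.2.2.1) (isoY α ρ p q) :=
    ContinuousOn.comp (g := ρ') (f := fun w : ℝ × ℝ × ℝ × ℝ × ℝ => w.2.2.1) cρ' cz hm
  constructor
  · refine ContinuousOn.prodMk ?_ (ContinuousOn.prodMk ?_ (ContinuousOn.prodMk cz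
      (ContinuousOn.prodMk ?_ ?_)))
    · refine iso_scale_cont _ (fun w => w.1) (fun w => α w.2.2.1) (fun w => α' w.2.2.1) (by fun_prop)
        kα kα' ?_ (fun w hw => hα' _ (hm hw)) (fun w hw => h1 _ (hm hw))
      intro w hw
      have := hw.2.1
      nlinarith [sq_nonneg w.2.1]
    · refine iso_scale_cont _ (fun w => w.2.1) (fun w => α w.2.2.1) (fun w => α' w.2.2.1) (by fun_prop)
        kα kα' ?_ (fun w hw => hα' _ (hm hw)) (fun w hw => h1 _ (hm hw))
      intro w hw
      have := hw.2.1
      nlinarith [sq_nonneg w.1]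
    · refine iso_scale_cont _ (fun w => w.2.2.2.1) (fun w => ρ w.2.2.1) (fun w => ρ' w.2.2.1) (by fun_prop)
        kρ kρ' ?_ (fun w hw => hρ' _ (hm hw)) (fun w hw => h3 _ (hm hw))
      intro w hw
      have := hw.2.2
      nlinarith [sq_nonneg w.2.2.2.2]
    · refine iso_scale_cont _ (fun w => w.2.2.2.2) (fun w => ρ w.2.2.1) (fun w => ρ' w.2.2.1) (by fun_prop)
        kρ kρ' ?_ (fun w hw => hρ' _ (hm hw)) (fun w hw => h3 _ (hm hw))
      intro w hw
      have := hw.2.2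
      nlinarith [sq_nonneg w.2.2.2.1]
  · rintro ⟨a, b, c, u, v⟩ hw
    have hc : c ∈ Icc p q := hw.1
    rw [isoY_mem] at hw
    rw [isoY_mem]
    refine ⟨hc, ?_, ?_⟩
    · simp only
      rw [mul_pow, mul_pow, ← mul_add, hw.2.1, Real.sq_sqrt (div_nonneg (hα' c hc) (hα c hc))]
      by_cases h : α c = 0
      · simp [h, h1 c hc h]
      · field_simp
    · simp only
      rw [mul_pow, mul_pow, ← mul_add, hw.2.2, Real.sq_sqrt (div_nonneg (hρ' c hc) (hρ c hc))]
      by_cases h : ρ c = 0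
      · simp [h, h3 c hc h]
      · field_simp

theorem isoY_rescale (α ρ α' ρ' : ℝ → ℝ) (p q : ℝ)
    (hα : ∀ z ∈ Icc p q, 0 ≤ α z) (hα' : ∀ z ∈ Icc p q, 0 ≤ α' z)
    (hρ : ∀ z ∈ Icc p q, 0 ≤ ρ z) (hρ' : ∀ z ∈ Icc p q, 0 ≤ ρ' z)
    (h1 : ∀ z ∈ Icc p q, α z = 0 ↔ α' z = 0)
    (h3 : ∀ z ∈ Icc p q, ρ z = 0 ↔ ρ' z = 0)
    (cα : ContinuousOn α (Icc p q)) (cα' : ContinuousOn α' (Icc p q))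
    (cρ : ContinuousOn ρ (Icc p q)) (cρ' : ContinuousOn ρ' (Icc p q)) :
    Nonempty (isoY α ρ p q ≃ₜ isoY α' ρ' p q) := by
  have A := isoY_rescale_aux α ρ α' ρ' p q hα hα' hρ hρ' (fun z hz => (h1 z hz).1)
    (fun z hz => (h3 z hz).1) cα cα' cρ cρ'
  have B := isoY_rescale_aux α' ρ' α ρ p q hα' hα hρ' hρ (fun z hz => (h1 z hz).2)
    (fun z hz => (h3 z hz).2) cα' cα cρ' cρ
  refine ⟨iso_mk _ _ _ _ A.1 B.1 A.2 B.2 ?_ ?_⟩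
  · rintro ⟨a, b, c, u, v⟩ hw
    have hc : c ∈ Icc p q := hw.1
    rw [isoY_mem] at hw
    simp only [Prod.mk.injEq, true_and]
    refine ⟨?_, ?_, ?_, ?_⟩
    · exact iso_sqrt_cancel (hα c hc) (hα' c hc) (h1 c hc).2 (by nlinarith [sq_nonneg b])
    · exact iso_sqrt_cancel (hα c hc) (hα' c hc) (h1 c hc).2 (by nlinarith [sq_nonneg a])
    · exact iso_sqrt_cancel (hρ c hc) (hρ' c hc) (h3 c hc).2 (by nlinarith [sq_nonneg v])
    · exact iso_sqrt_cancel (hρ c hc) (hρ' c hc) (h3 c hc).2 (by nlinarith [sq_nonneg u])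
  · rintro ⟨a, b, c, u, v⟩ hw
    have hc : c ∈ Icc p q := hw.1
    rw [isoY_mem] at hw
    simp only [Prod.mk.injEq, true_and]
    refine ⟨?_, ?_, ?_, ?_⟩
    · exact iso_sqrt_cancel (hα' c hc) (hα c hc) (h1 c hc).1 (by nlinarith [sq_nonneg b])
    · exact iso_sqrt_cancel (hα' c hc) (hα c hc) (h1 c hc).1 (by nlinarith [sq_nonneg a])
    · exact iso_sqrt_cancel (hρ' c hc) (hρ c hc) (h3 c hc).1 (by nlinarith [sq_nonneg v])
    · exact iso_sqrt_cancel (hρ' c hc) (hρ c hc) (h3 c hc).1 (by nlinarith [sq_nonneg u])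

theorem iso_mem_sphere1 (x : EuclideanSpace ℝ (Fin 2)) :
    x ∈ Metric.sphere (0 : EuclideanSpace ℝ (Fin 2)) 1 ↔ x 0 ^ 2 + x 1 ^ 2 = 1 := by
  rw [mem_sphere_zero_iff_norm, EuclideanSpace.norm_eq, Real.sqrt_eq_one]
  simp [Fin.sum_univ_succ]

theorem iso_mem_sphere2 (x : EuclideanSpace ℝ (Fin 3)) :
    x ∈ Metric.sphere (0 : EuclideanSpace ℝ (Fin 3)) 1 ↔ x 0 ^ 2 + x 1 ^ 2 + x 2 ^ 2 = 1 := by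
  rw [mem_sphere_zero_iff_norm, EuclideanSpace.norm_eq, Real.sqrt_eq_one]
  simp [Fin.sum_univ_succ, add_assoc]

theorem iso_mem_sphere3 (x : EuclideanSpace ℝ (Fin 4)) :
    x ∈ Metric.sphere (0 : EuclideanSpace ℝ (Fin 4)) 1 ↔
      x 0 ^ 2 + x 1 ^ 2 + x 2 ^ 2 + x 3 ^ 2 = 1 := by
  rw [mem_sphere_zero_iff_norm, EuclideanSpace.norm_eq, Real.sqrt_eq_one]
  simp [Fin.sum_univ_succ, add_assoc]

theorem isoY_S3 (q : ℝ) (hq : -1 < q) :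
    Nonempty (isoY (fun z => 1 + z) (fun z => q - z) (-1) q ≃ₜ sphereS 3) := by
  have hc : 0 < √(1 + q) := Real.sqrt_pos.2 (by linarith)
  have hc2 : √(1 + q) ^ 2 = 1 + q := Real.sq_sqrt (by linarith)
  set k := √(1 + q) with hk
  refine ⟨iso_mk _ _
    (fun w => !₂[w.1 / k, w.2.1 / k, w.2.2.2.1 / k, w.2.2.2.2 / k])
    (fun x => (k * x 0, k * x 1, k ^ 2 * (x 0 ^ 2 + x 1 ^ 2) - 1, k * x 2, k * x 3)) ?_ ?_
    ?_ ?_ ?_ ?_⟩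
  · apply Continuous.continuousOn
    apply (PiLp.continuous_toLp 2 _).comp
    fun_prop
  · fun_prop
  · rintro ⟨a, b, c, u, v⟩ h
    rw [isoY_mem] at h
    rw [iso_mem_sphere3]
    obtain ⟨h1, h2, h3⟩ := h
    simp
    field_simp
    linarith
  · intro x h
    rw [iso_mem_sphere3] at h
    rw [isoY_mem]
    refine ⟨⟨?_, ?_⟩, by ring, ?_⟩
    · have : 0 ≤ k ^ 2 * (x 0 ^ 2 + x 1 ^ 2) := by positivity
      linarith
    · have h4 : 0 ≤ k ^ 2 * (x 2 ^ 2 + x 3 ^ 2) := by positivity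
      have h5 : k ^ 2 * (x 2 ^ 2 + x 3 ^ 2) + k ^ 2 * (x 0 ^ 2 + x 1 ^ 2) = 1 + q := by
        rw [← mul_add, ← hc2]
        have : x 2 ^ 2 + x 3 ^ 2 + (x 0 ^ 2 + x 1 ^ 2) = 1 := by linarith
        rw [this, mul_one]
      linarith
    · have h5 : k ^ 2 * (x 2 ^ 2 + x 3 ^ 2) + k ^ 2 * (x 0 ^ 2 + x 1 ^ 2) = 1 + q := by
        rw [← mul_add, ← hc2]
        have : x 2 ^ 2 + x 3 ^ 2 + (x 0 ^ 2 + x 1 ^ 2) = 1 := by linarith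
        rw [this, mul_one]
      simp only
      linarith
  · rintro ⟨a, b, c, u, v⟩ h
    rw [isoY_mem] at h
    obtain ⟨h1, h2, h3⟩ := h
    simp
    field_simp
    simp
    linarith
  · intro x h
    ext i
    fin_cases i <;> simp <;> field_simp

theorem isoY_S12 (p q : ℝ) (hpq : p < q) :
    Nonempty (isoY (fun _ => 1) (fun z => (q - z) * (z - p)) p q ≃ₜ sphereS 1 × sphereS 2) := by
  have hd : 0 < q - p := by linarith
  let e : (Metric.sphere (0 : EuclideanSpace ℝ (Fin 2)) 1 ×ˢ
      Metric.sphere (0 : EuclideanSpace ℝ (Fin 3)) 1 : Set _) ≃ₜ sphereS 1 × sphereS 2 :=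
    Homeomorph.Set.prod _ _
  refine ⟨(iso_mk _ (Metric.sphere (0 : EuclideanSpace ℝ (Fin 2)) 1 ×ˢ
      Metric.sphere (0 : EuclideanSpace ℝ (Fin 3)) 1)
    (fun w => (!₂[w.1, w.2.1], !₂[2 * w.2.2.2.1 / (q - p), 2 * w.2.2.2.2 / (q - p),
      (2 * w.2.2.1 - p - q) / (q - p)]))
    (fun x => (x.1 0, x.1 1, ((q - p) * x.2 2 + p + q) / 2, (q - p) / 2 * x.2 0,
      (q - p) / 2 * x.2 1)) ?_ ?_
    ?_ ?_ ?_ ?_).trans e⟩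
  · apply Continuous.continuousOn
    apply Continuous.prodMk
    · apply (PiLp.continuous_toLp 2 _).comp
      fun_prop
    · apply (PiLp.continuous_toLp 2 _).comp
      fun_prop
  · fun_prop
  · rintro ⟨a, b, c, u, v⟩ h
    rw [isoY_mem] at h
    obtain ⟨h1, h2, h3⟩ := h
    rw [mem_prod, iso_mem_sphere1, iso_mem_sphere2]
    simp
    refine ⟨h2, ?_⟩
    field_simp
    linear_combination 4 * h3
  · rintro ⟨x, y⟩ h
    rw [mem_prod, iso_mem_sphere1, iso_mem_sphere2] at h
    rw [isoY_mem]
    obtain ⟨h1, h2⟩ := h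
    simp only at h1 h2 ⊢
    have h3 : -1 ≤ y 2 := by nlinarith [sq_nonneg (y 0), sq_nonneg (y 1)]
    have h4 : y 2 ≤ 1 := by nlinarith [sq_nonneg (y 0), sq_nonneg (y 1)]
    refine ⟨⟨by nlinarith, by nlinarith⟩, h1, ?_⟩
    linear_combination (q - p) ^ 2 / 4 * h2
  · rintro ⟨a, b, c, u, v⟩ h
    simp
    refine ⟨?_, ?_, ?_⟩ <;> field_simp
    ring
  · rintro ⟨x, y⟩ h
    rw [Prod.mk.injEq]
    constructor
    · ext i
      fin_cases i <;> simp
    · ext i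
      fin_cases i <;> simp <;> field_simp
      ring

theorem isoX_S3 (ρ : ℝ → ℝ) (q : ℝ) (hq : -1 < q) (hq1 : q < 1) (cρ : ContinuousOn ρ (Icc (-1) q))
    (h0 : ρ q = 0) (hpos : ∀ z, -1 ≤ z → z < q → 0 < ρ z) :
    Nonempty (isoX ρ (-1) q ≃ₜ sphereS 3) := by
  obtain ⟨e1⟩ := isoX_frame ρ (-1) q hq1
  obtain ⟨e3⟩ := isoY_S3 q hq
  obtain ⟨e2⟩ := isoY_rescale (fun z => 1 - z ^ 2) ρ (fun z => 1 + z) (fun z => q - z) (-1) q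
    (by rintro z ⟨h1, h2⟩; nlinarith) (by rintro z ⟨h1, h2⟩; linarith)
    (by
      rintro z ⟨h1, h2⟩
      rcases h2.lt_or_eq with h | h
      · exact (hpos z h1 h).le
      · rw [h, h0])
    (by rintro z ⟨h1, h2⟩; linarith)
    (by
      rintro z ⟨h1, h2⟩
      rw [show 1 - z ^ 2 = (1 - z) * (1 + z) by ring, mul_eq_zero]
      constructor
      · rintro (h | h)
        · linarith
        · exact h
      · exact Or.inr)
    (by
      rintro z ⟨h1, h2⟩
      rcases h2.lt_or_eq with h | h
      · have := hpos z h1 h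
        constructor
        · intro h'; linarith
        · intro h'; linarith
      · simp [h, h0])
    (by fun_prop) (by fun_prop) cρ (by fun_prop)
  exact ⟨(e1.trans e2).trans e3⟩

theorem isoX_S12 (ρ : ℝ → ℝ) (p q : ℝ) (hp : -1 < p) (hpq : p < q) (hq1 : q < 1)
    (cρ : ContinuousOn ρ (Icc p q))
    (h0 : ρ p = 0) (h1 : ρ q = 0) (hpos : ∀ z, p < z → z < q → 0 < ρ z) :
    Nonempty (isoX ρ p q ≃ₜ sphereS 1 × sphereS 2) := by
  obtain ⟨e1⟩ := isoX_frame ρ p q hq1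
  obtain ⟨e3⟩ := isoY_S12 p q hpq
  obtain ⟨e2⟩ := isoY_rescale (fun z => 1 - z ^ 2) ρ (fun _ => 1) (fun z => (q - z) * (z - p)) p q
    (by rintro z ⟨h1, h2⟩; nlinarith) (by rintro z ⟨h1, h2⟩; linarith)
    (by
      rintro z ⟨h3, h2⟩
      rcases h2.lt_or_eq with h | h
      · rcases h3.lt_or_eq with h' | h'
        · exact (hpos z h' h).le
        · rw [← h', h0]
      · rw [h, h1])
    (by rintro z ⟨h1, h2⟩; nlinarith)
    (by
      rintro z ⟨h1, h2⟩
      constructor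
      · intro h
        nlinarith
      · intro h
        linarith)
    (by
      rintro z ⟨h3, h2⟩
      rcases h2.lt_or_eq with h | h
      · rcases h3.lt_or_eq with h' | h'
        · have := hpos z h' h
          constructor
          · intro h'; linarith
          · intro h''; nlinarith
        · simp [← h', h0]
      · simp [h, h1])
    (by fun_prop) (by fun_prop) cρ (by fun_prop)
  exact ⟨(e1.trans e2).trans e3⟩


/-- A quaternion from its four coordinates. -/
def iso_q (a b c d : ℝ) : Quaternion ℝ := ⟨a, b, c, d⟩

@[simp] theorem iso_q_re (a b c d : ℝ) : (iso_q a b c d).re = a := rfl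
@[simp] theorem iso_q_imI (a b c d : ℝ) : (iso_q a b c d).imI = b := rfl
@[simp] theorem iso_q_imJ (a b c d : ℝ) : (iso_q a b c d).imJ = c := rfl
@[simp] theorem iso_q_imK (a b c d : ℝ) : (iso_q a b c d).imK = d := rfl

@[simp] theorem iso_one_re : (1 : Quaternion ℝ).re = 1 := rfl
@[simp] theorem iso_one_imI : (1 : Quaternion ℝ).imI = 0 := rfl
@[simp] theorem iso_one_imJ : (1 : Quaternion ℝ).imJ = 0 := rfl
@[simp] theorem iso_one_imK : (1 : Quaternion ℝ).imK = 0 := rfl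

theorem iso_quat_A (x y z : ℝ) (h : x ^ 2 + y ^ 2 + z ^ 2 = 1) :
    ∃ p : Quaternion ℝ, p * star p = 1 ∧ p * (iso_q 0 1 0 0) * star p = (iso_q 0 x y z) := by
  by_cases hx : x = -1
  · have h' : y ^ 2 + z ^ 2 = 0 := by rw [hx] at h; linarith
    have hy : y = 0 := by nlinarith [sq_nonneg y, sq_nonneg z]
    have hz : z = 0 := by nlinarith [sq_nonneg y, sq_nonneg z]
    refine ⟨(iso_q 0 0 1 0), ?_, ?_⟩
    · refine Quaternion.ext _ _ ?_ ?_ ?_ ?_ <;> simp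
    · refine Quaternion.ext _ _ ?_ ?_ ?_ ?_ <;> simp [hx, hy, hz]
  · have hx1 : 0 < 2 + 2 * x := by
      have : -1 ≤ x := by nlinarith [sq_nonneg y, sq_nonneg z]
      have : -1 < x := lt_of_le_of_ne this (Ne.symm hx)
      linarith
    obtain ⟨k, hk⟩ : ∃ k : ℝ, k ^ 2 * (2 + 2 * x) = 1 := by
      refine ⟨(√(2 + 2 * x))⁻¹, ?_⟩
      rw [inv_pow, Real.sq_sqrt hx1.le]
      exact inv_mul_cancel₀ hx1.ne'
    refine ⟨(iso_q (k * (1 + x)) 0 (- k * z) (k * y)), ?_, ?_⟩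
    · refine Quaternion.ext _ _ ?_ ?_ ?_ ?_ <;> simp
      · linear_combination hk + k ^ 2 * h
      · ring
      · ring
      · ring
    · refine Quaternion.ext _ _ ?_ ?_ ?_ ?_ <;> simp
      · ring
      · linear_combination x * hk - k ^ 2 * h
      · linear_combination y * hk
      · linear_combination z * hk

theorem iso_quat_surj (a b c u v w : ℝ) (h1 : a ^ 2 + b ^ 2 + c ^ 2 = 1)
    (h2 : a * u + b * v + c * w = 0) (h3 : u ^ 2 + v ^ 2 + w ^ 2 = 1) :
    ∃ q : Quaternion ℝ, q * star q = 1 ∧ q * (iso_q 0 1 0 0) * star q = (iso_q 0 a b c) ∧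
      q * (iso_q 0 0 1 0) * star q = (iso_q 0 u v w) := by
  obtain ⟨p, hp, hpI⟩ := iso_quat_A a b c h1
  have hp' : star p * p = 1 := by rw [star_comm_self']; exact hp
  have comm : ∀ x y : Quaternion ℝ, (x * y).re = (y * x).re := by
    intro x y; simp; ring
  obtain ⟨U, hU⟩ : ∃ U : Quaternion ℝ, U = (iso_q 0 u v w) := ⟨_, rfl⟩
  obtain ⟨T, hT⟩ : ∃ T : Quaternion ℝ, T = star p * U * p := ⟨_, rfl⟩
  have hT0 : T.re = 0 := by
    rw [hT, comm, ← mul_assoc, hp, one_mul, hU]; rfl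
  have hT1 : T.imI = 0 := by
    have e : (T * (iso_q 0 1 0 0)).re = - T.imI := by simp
    have e2 : (T * (iso_q 0 1 0 0)).re = (U * (p * (iso_q 0 1 0 0) * star p)).re := by
      rw [hT, show star p * U * p * ((iso_q 0 1 0 0) : Quaternion ℝ)
        = star p * (U * (p * (iso_q 0 1 0 0))) by simp only [mul_assoc], comm]
      simp only [mul_assoc]
    rw [hpI, hU] at e2
    simp at e2
    linarith
  have hTn : T.imJ ^ 2 + T.imK ^ 2 = 1 := by
    have e : T * star T = 1 := by
      have eU : U * star U = 1 := by
        rw [hU]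
        refine Quaternion.ext _ _ ?_ ?_ ?_ ?_ <;> simp
        · linarith
        · ring
        · ring
        · ring
      rw [hT]
      simp only [star_mul, star_star]
      calc star p * U * p * (star p * (star U * p)) = star p * (U * ((p * star p) * star U)) * p := by
            simp only [mul_assoc]
        _ = 1 := by rw [hp, one_mul, eU, mul_one, hp']
    have := congrArg (fun x : Quaternion ℝ => x.re) e
    simp [hT0, hT1] at this
    linarith
  obtain ⟨z, hz⟩ := IsAlgClosed.exists_pow_nat_eq (⟨T.imJ, T.imK⟩ : ℂ) (n := 2) (by norm_num)
  have hzr : z.re ^ 2 - z.im ^ 2 = T.imJ := by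
    have := congrArg Complex.re hz
    simp [pow_two] at this
    linarith
  have hzi : 2 * z.re * z.im = T.imK := by
    have := congrArg Complex.im hz
    simp [pow_two] at this
    linarith
  have hzn : z.re ^ 2 + z.im ^ 2 = 1 := by
    have e : (z.re ^ 2 + z.im ^ 2) ^ 2 = 1 := by
      rw [← hTn, ← hzr, ← hzi]; ring
    have : 0 ≤ z.re ^ 2 + z.im ^ 2 := by positivity
    nlinarith
  obtain ⟨r, hr⟩ : ∃ r : Quaternion ℝ, r = (iso_q z.re z.im 0 0) := ⟨_, rfl⟩
  have r1 : r * star r = 1 := by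
    rw [hr]; refine Quaternion.ext _ _ ?_ ?_ ?_ ?_ <;> simp
    · linarith
    · ring
  have rI : r * (iso_q 0 1 0 0) * star r = (iso_q 0 1 0 0) := by
    rw [hr]; refine Quaternion.ext _ _ ?_ ?_ ?_ ?_ <;> simp
    · ring
    · linarith
  have rJ : r * (iso_q 0 0 1 0) * star r = T := by
    rw [hr]; refine Quaternion.ext _ _ ?_ ?_ ?_ ?_ <;> simp [hT0, hT1]
    · linarith
    · linarith
  refine ⟨p * r, ?_, ?_, ?_⟩
  · rw [star_mul, ← mul_assoc, mul_assoc p, r1, mul_one, hp]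
  · rw [star_mul, ← hpI]
    nth_rewrite 2 [← rI]
    simp only [mul_assoc]
  · rw [star_mul, ← hU]
    calc p * r * (iso_q 0 0 1 0) * (star r * star p) = p * (r * (iso_q 0 0 1 0) * star r) * star p := by
          simp only [mul_assoc]
      _ = (p * star p) * U * (p * star p) := by rw [rJ, hT]; simp only [mul_assoc]
      _ = U := by rw [hp]; simp

theorem iso_quat_inj (p q : Quaternion ℝ) (hp : p * star p = 1) (hq : q * star q = 1)
    (hI : p * (iso_q 0 1 0 0) * star p = q * (iso_q 0 1 0 0) * star q)
    (hJ : p * (iso_q 0 0 1 0) * star p = q * (iso_q 0 0 1 0) * star q) : p = q ∨ p = -q := by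
  have hp' : star p * p = 1 := by rw [star_comm_self']; exact hp
  have hq' : star q * q = 1 := by rw [star_comm_self']; exact hq
  obtain ⟨s, hs⟩ : ∃ s : Quaternion ℝ, s = star q * p := ⟨_, rfl⟩
  have key : ∀ A : Quaternion ℝ, p * A * star p = q * A * star q → s * A = A * s := by
    intro A h
    calc s * A = star q * (p * A * star p) * p := by
          rw [hs]
          simp only [mul_assoc, hp', mul_one]
      _ = A * s := by
          rw [h, hs]
          simp only [← mul_assoc, hq', one_mul]
  have kI := key _ hI
  have kJ := key _ hJ
  have e1 := congrArg (fun x : Quaternion ℝ => x.imK) kI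
  have e2 := congrArg (fun x : Quaternion ℝ => x.imJ) kI
  have e3 := congrArg (fun x : Quaternion ℝ => x.imK) kJ
  simp at e1 e2 e3
  have f1 : s.imJ = 0 := by linarith
  have f2 : s.imK = 0 := by linarith
  have f3 : s.imI = 0 := by linarith
  have hps : p = q * s := by rw [hs, ← mul_assoc, hq, one_mul]
  have hss : s * star s = 1 := by
    rw [hs, star_mul, star_star, ← mul_assoc, mul_assoc (star q), hp, mul_one, hq']
  have e4 := congrArg (fun x : Quaternion ℝ => x.re) hss
  simp [f1, f2, f3] at e4
  have e5 : (s.re - 1) * (s.re + 1) = 0 := by linarith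
  rcases mul_eq_zero.1 e5 with h | h
  · left
    have : s = 1 := by
      refine Quaternion.ext _ _ ?_ ?_ ?_ ?_ <;> simp [f1, f2, f3]
      linarith
    rw [hps, this, mul_one]
  · right
    have : s = -1 := by
      refine Quaternion.ext _ _ ?_ ?_ ?_ ?_ <;> simp [f1, f2, f3]
      linarith
    rw [hps, this, mul_neg, mul_one]

/-- Double cover of the unit tangent bundle of S². -/
def iso_cover (x : EuclideanSpace ℝ (Fin 4)) : ℝ × ℝ × ℝ × ℝ × ℝ × ℝ :=
  (x 0 ^ 2 + x 1 ^ 2 - x 2 ^ 2 - x 3 ^ 2, 2 * (x 1 * x 2 + x 0 * x 3), 2 * (x 1 * x 3 - x 0 * x 2),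
   2 * (x 1 * x 2 - x 0 * x 3), x 0 ^ 2 - x 1 ^ 2 + x 2 ^ 2 - x 3 ^ 2, 2 * (x 2 * x 3 + x 0 * x 1))

theorem iso_cover_I (x : EuclideanSpace ℝ (Fin 4)) :
    ((iso_q (x 0) (x 1) (x 2) (x 3)) * (iso_q 0 1 0 0) * star (iso_q (x 0) (x 1) (x 2) (x 3)) : Quaternion ℝ) =
    (iso_q 0 ((iso_cover x).1) ((iso_cover x).2.1) ((iso_cover x).2.2.1)) := by
  refine Quaternion.ext _ _ ?_ ?_ ?_ ?_ <;> simp [iso_cover] <;> ring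

theorem iso_cover_J (x : EuclideanSpace ℝ (Fin 4)) :
    ((iso_q (x 0) (x 1) (x 2) (x 3)) * (iso_q 0 0 1 0) * star (iso_q (x 0) (x 1) (x 2) (x 3)) : Quaternion ℝ) =
    (iso_q 0 ((iso_cover x).2.2.2.1) ((iso_cover x).2.2.2.2.1) ((iso_cover x).2.2.2.2.2)) := by
  refine Quaternion.ext _ _ ?_ ?_ ?_ ?_ <;> simp [iso_cover] <;> ring

theorem iso_quat_unit (a b c d : ℝ) :
    ((iso_q a b c d) * star (iso_q a b c d) : Quaternion ℝ) = 1 ↔ a ^ 2 + b ^ 2 + c ^ 2 + d ^ 2 = 1 := by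
  constructor
  · intro h
    have := congrArg (fun x : Quaternion ℝ => x.re) h
    simp at this
    linarith
  · intro h
    refine Quaternion.ext _ _ ?_ ?_ ?_ ?_ <;> simp
    · linarith
    · ring
    · ring
    · ring

theorem iso_cover_mem (x : EuclideanSpace ℝ (Fin 4))
    (hx : x ∈ Metric.sphere (0 : EuclideanSpace ℝ (Fin 4)) 1) :
    iso_cover x ∈ isoX (fun _ => 1) (-1) 1 := by
  rw [iso_mem_sphere3] at hx
  unfold iso_cover
  rw [isoX_mem]
  generalize x 0 = a at *
  generalize x 1 = b at *
  generalize x 2 = c at *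
  generalize x 3 = d at *
  have e : (a ^ 2 + b ^ 2 + c ^ 2 + d ^ 2) ^ 2 = 1 := by rw [hx, one_pow]
  have e1 : (a ^ 2 + b ^ 2 - c ^ 2 - d ^ 2) ^ 2 + (2 * (b * c + a * d)) ^ 2
      + (2 * (b * d - a * c)) ^ 2 = 1 := by
    rw [← e]; ring
  refine ⟨e1, ⟨?_, ?_⟩, by ring, ?_⟩
  · nlinarith [sq_nonneg (a ^ 2 + b ^ 2 - c ^ 2 - d ^ 2), sq_nonneg (2 * (b * c + a * d))]
  · nlinarith [sq_nonneg (a ^ 2 + b ^ 2 - c ^ 2 - d ^ 2), sq_nonneg (2 * (b * c + a * d))]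
  · rw [← e]; ring

theorem iso_RP3_unit : Nonempty (isoX (fun _ => 1) (-1) 1 ≃ₜ RP3) := by
  let F : sphereS 3 → isoX (fun _ => 1) (-1) 1 := fun x => ⟨iso_cover x, iso_cover_mem x x.2⟩
  have hF : Continuous F := by
    apply Continuous.subtype_mk
    unfold iso_cover
    fun_prop
  have hinv : ∀ x y : sphereS 3, antipodal.r x y → F x = F y := by
    intro x y h
    apply Subtype.ext
    show iso_cover x = iso_cover y
    rcases h with h | h
    · rw [h]
    · rw [h]
      simp [iso_cover]
  let G : Quotient antipodal → isoX (fun _ => 1) (-1) 1 := Quotient.lift F hinv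
  have hG : Continuous G := hF.quotient_lift hinv
  have hbij : Function.Bijective G := by
    constructor
    · intro x y
      induction x using Quotient.inductionOn with | _ x
      induction y using Quotient.inductionOn with | _ y
      intro h
      have h' : iso_cover x = iso_cover y := congrArg Subtype.val h
      apply Quotient.sound
      have hx := (iso_mem_sphere3 _).1 x.2
      have hy := (iso_mem_sphere3 _).1 y.2
      rcases iso_quat_inj _ _ ((iso_quat_unit _ _ _ _).2 hx) ((iso_quat_unit _ _ _ _).2 hy)
        (by rw [iso_cover_I, iso_cover_I, h']) (by rw [iso_cover_J, iso_cover_J, h']) with e | e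
      · left
        rw [Quaternion.ext_iff] at e
        simp only [iso_q_re, iso_q_imI, iso_q_imJ, iso_q_imK] at e
        ext i
        fin_cases i
        · exact e.1
        · exact e.2.1
        · exact e.2.2.1
        · exact e.2.2.2
      · right
        rw [Quaternion.ext_iff] at e
        simp at e
        ext i
        fin_cases i
        · exact e.1
        · exact e.2.1
        · exact e.2.2.1
        · exact e.2.2.2
    · rintro ⟨⟨a, b, c, u, v, w⟩, h⟩
      have h0 := h
      rw [isoX_mem] at h0
      obtain ⟨q, h1, h2, h3⟩ := iso_quat_surj a b c u v w h0.1 h0.2.2.1 h0.2.2.2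
      have hq : q = iso_q q.re q.imI q.imJ q.imK := rfl
      let x : EuclideanSpace ℝ (Fin 4) := !₂[q.re, q.imI, q.imJ, q.imK]
      have hqx : q = iso_q (x 0) (x 1) (x 2) (x 3) := by
        refine Quaternion.ext _ _ ?_ ?_ ?_ ?_ <;> simp [x]
      have hx : x ∈ Metric.sphere (0 : EuclideanSpace ℝ (Fin 4)) 1 := by
        rw [iso_mem_sphere3, ← iso_quat_unit, ← hqx]
        exact h1
      refine ⟨Quotient.mk antipodal ⟨x, hx⟩, ?_⟩
      apply Subtype.ext
      show iso_cover x = (a, b, c, u, v, w)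
      rw [hqx, iso_cover_I, Quaternion.ext_iff] at h2
      rw [hqx, iso_cover_J, Quaternion.ext_iff] at h3
      simp only [iso_q_re, iso_q_imI, iso_q_imJ, iso_q_imK] at h2 h3
      ext1
      · exact h2.2.1
      ext1
      · exact h2.2.2.1
      ext1
      · exact h2.2.2.2
      ext1
      · exact h3.2.1
      ext1
      · exact h3.2.2.1
      · exact h3.2.2.2
  have hG' : IsHomeomorph G := isHomeomorph_iff_continuous_bijective.2 ⟨hG, hbij⟩
  exact ⟨(hG'.homeomorph G).symm⟩

theorem isoX_RP3 (ρ : ℝ → ℝ) (cρ : ContinuousOn ρ (Icc (-1) 1))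
    (hpos : ∀ z ∈ Icc (-1 : ℝ) 1, 0 < ρ z) : Nonempty (isoX ρ (-1) 1 ≃ₜ RP3) := by
  obtain ⟨e⟩ := iso_RP3_unit
  refine ⟨(iso_mk (isoX ρ (-1) 1) (isoX (fun _ => 1) (-1) 1)
    (fun w => (w.1, w.2.1, w.2.2.1, w.2.2.2.1 / √(ρ w.2.2.1), w.2.2.2.2.1 / √(ρ w.2.2.1),
      w.2.2.2.2.2 / √(ρ w.2.2.1)))
    (fun w => (w.1, w.2.1, w.2.2.1, w.2.2.2.1 * √(ρ w.2.2.1), w.2.2.2.2.1 * √(ρ w.2.2.1),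
      w.2.2.2.2.2 * √(ρ w.2.2.1))) ?_ ?_ ?_ ?_ ?_ ?_).trans e⟩
  · have h0 : ∀ w ∈ isoX ρ (-1) 1, √(ρ w.2.2.1) ≠ 0 := by
      intro w hw
      exact (Real.sqrt_pos.2 (hpos _ hw.2.1)).ne'
    have h1 : ContinuousOn (fun w : ℝ × ℝ × ℝ × ℝ × ℝ × ℝ => √(ρ w.2.2.1)) (isoX ρ (-1) 1) :=
      (ContinuousOn.comp (g := ρ) (f := fun w : ℝ × ℝ × ℝ × ℝ × ℝ × ℝ => w.2.2.1) cρ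
        (by fun_prop) (fun w hw => hw.2.1)).sqrt
    fun_prop (disch := assumption)
  · have h1 : ContinuousOn (fun w : ℝ × ℝ × ℝ × ℝ × ℝ × ℝ => √(ρ w.2.2.1))
        (isoX (fun _ => 1) (-1) 1) :=
      (ContinuousOn.comp (g := ρ) (f := fun w : ℝ × ℝ × ℝ × ℝ × ℝ × ℝ => w.2.2.1) cρ
        (by fun_prop) (fun w hw => hw.2.1)).sqrt
    fun_prop
  · rintro ⟨a, b, c, u, v, w⟩ h
    rw [isoX_mem] at h ⊢
    have hp := hpos c h.2.1
    have hs := Real.sqrt_pos.2 hp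
    have hs2 := Real.sq_sqrt hp.le
    refine ⟨h.1, h.2.1, ?_, ?_⟩
    · simp only
      field_simp
      linarith [h.2.2.1]
    · simp only
      field_simp
      linarith [h.2.2.2]
  · rintro ⟨a, b, c, u, v, w⟩ h
    rw [isoX_mem] at h ⊢
    have hp := hpos c h.2.1
    have hs2 := Real.sq_sqrt hp.le
    refine ⟨h.1, h.2.1, ?_, ?_⟩
    · simp only
      linear_combination √(ρ c) * h.2.2.1
    · simp only
      linear_combination √(ρ c) ^ 2 * h.2.2.2 + hs2
  · rintro ⟨a, b, c, u, v, w⟩ h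
    have hs := (Real.sqrt_pos.2 (hpos c h.2.1)).ne'
    simp [hs]
  · rintro ⟨a, b, c, u, v, w⟩ h
    have hs := (Real.sqrt_pos.2 (hpos c h.2.1)).ne'
    simp [hs]


/-- Regularity of the radius function: all zeros are interior and simple. -/
def iso_reg (ρ : ℝ → ℝ) : Prop :=
  ContinuousOn ρ (Icc (-1) 1) ∧ ∀ z ∈ Icc (-1 : ℝ) 1, ρ z = 0 →
    z ≠ -1 ∧ z ≠ 1 ∧ ∃ d, d ≠ 0 ∧ HasDerivAt ρ d z

theorem iso_reg_neg {ρ : ℝ → ℝ} (h : iso_reg ρ) : iso_reg (fun z => - ρ z) := by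
  refine ⟨h.1.neg, fun z hz h0 => ?_⟩
  obtain ⟨h1, h2, d, hd, hd'⟩ := h.2 z hz (neg_eq_zero.1 h0)
  exact ⟨h1, h2, -d, neg_ne_zero.2 hd, hd'.neg⟩

theorem iso_reg_reflect {ρ : ℝ → ℝ} (h : iso_reg ρ) : iso_reg (fun z => ρ (-z)) := by
  have hm : ∀ z ∈ Icc (-1 : ℝ) 1, -z ∈ Icc (-1 : ℝ) 1 := by
    intro z hz; exact ⟨by linarith [hz.2], by linarith [hz.1]⟩
  refine ⟨h.1.comp (by fun_prop) hm, fun z hz h0 => ?_⟩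
  obtain ⟨h1, h2, d, hd, hd'⟩ := h.2 (-z) (hm z hz) h0
  refine ⟨fun e => h2 (by rw [e]; ring), fun e => h1 (by rw [e]), -d, neg_ne_zero.2 hd, ?_⟩
  have := HasDerivAt.scomp z hd' (hasDerivAt_neg z)
  simp only [smul_eq_mul, neg_mul, one_mul] at this
  exact this

theorem iso_reg_finite {ρ : ℝ → ℝ} (h : iso_reg ρ) : {z ∈ Icc (-1 : ℝ) 1 | ρ z = 0}.Finite := by
  by_contra hinf
  obtain ⟨x, hx, hacc⟩ := Set.Infinite.exists_accPt_of_subset_isCompact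
    (s := {z ∈ Icc (-1 : ℝ) 1 | ρ z = 0}) hinf isCompact_Icc (fun z hz => hz.1)
  have hcl : IsClosed {z ∈ Icc (-1 : ℝ) 1 | ρ z = 0} :=
    h.1.preimage_isClosed_of_isClosed isClosed_Icc isClosed_singleton
  have hx0 : x ∈ {z ∈ Icc (-1 : ℝ) 1 | ρ z = 0} := hcl.closure_subset_iff.2 le_rfl
    (mem_closure_iff_clusterPt.2 hacc.clusterPt)
  obtain ⟨_, _, d, hd, hd'⟩ := h.2 x hx hx0.2
  have h1 := hd'.eventually_ne (c := 0) hd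
  rw [accPt_iff_frequently_nhdsNE] at hacc
  exact hacc (h1.mono fun z hz hz' => hz hz'.2)

theorem iso_local {ρ : ℝ → ℝ} {z d : ℝ} (h0 : ρ z = 0) (hd : d ≠ 0) (h : HasDerivAt ρ d z) :
    ∃ ε > 0, ∀ w, w ≠ z → |w - z| < ε → 0 < ρ w * d * (w - z) := by
  have h1 := hasDerivAt_iff_tendsto_slope.1 h
  have h2 : ∀ᶠ w in 𝓝[≠] z, 0 < slope ρ z w * d :=
    (h1.mul_const d).eventually (lt_mem_nhds (mul_self_pos.2 hd))
  rw [eventually_nhdsWithin_iff, Metric.eventually_nhds_iff] at h2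
  obtain ⟨ε, hε, h3⟩ := h2
  refine ⟨ε, hε, fun w hw hw2 => ?_⟩
  have h4 := h3 (by rwa [Real.dist_eq]) hw
  rw [slope_def_field, h0, sub_zero] at h4
  have h5 : w - z ≠ 0 := sub_ne_zero.2 hw
  have h6 : 0 < (w - z) ^ 2 := by positivity
  have h7 := mul_pos h4 h6
  have h8 : ρ w / (w - z) * d * (w - z) ^ 2 = ρ w * d * (w - z) := by field_simp
  linarith

theorem iso_nz {ρ : ℝ → ℝ} (h : iso_reg ρ) (v q : ℝ) (hv : -1 ≤ v) (hq : q ≤ 1)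
    (hv0 : 0 < ρ v) (hq0 : ρ q ≠ 0) (hex : ∃ z ∈ Icc v q, ρ z = 0) :
    ∃ z c, v < z ∧ z < c ∧ c < q ∧ ρ z = 0 ∧ (∀ t, v ≤ t → t < z → 0 < ρ t) ∧
      (∀ t, z < t → t ≤ c → ρ t < 0) := by
  have hsub : Icc v q ⊆ Icc (-1) 1 := Icc_subset_Icc hv hq
  have hfin : {z ∈ Icc v q | ρ z = 0}.Finite :=
    (iso_reg_finite h).subset fun z hz => ⟨hsub hz.1, hz.2⟩
  obtain ⟨z, hz, hmin⟩ := Set.exists_min_image _ id hfin hex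
  simp only [id] at hmin
  have hvz : v < z := lt_of_le_of_ne hz.1.1 (by rintro rfl; exact hv0.ne' hz.2)
  have hzq : z < q := lt_of_le_of_ne hz.1.2 (by rintro rfl; exact hq0 hz.2)
  have hpos : ∀ t, v ≤ t → t < z → 0 < ρ t := by
    intro t ht htz
    by_contra hneg
    push Not at hneg
    have hivt := intermediate_value_Icc' ht (h.1.mono (Icc_subset_Icc hv (by linarith)))
    obtain ⟨s, hs, hs0⟩ := hivt ⟨hneg, hv0.le⟩
    have := hmin s ⟨⟨hs.1, by linarith [hs.2]⟩, hs0⟩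
    linarith [hs.2]
  obtain ⟨_, _, d, hd, hd'⟩ := h.2 z (hsub hz.1) hz.2
  obtain ⟨ε, hε, hloc⟩ := iso_local hz.2 hd hd'
  have hdneg : d < 0 := by
    obtain ⟨t, ht1, ht2⟩ := exists_between (max_lt hvz (by linarith : z - ε < z))
    have ht3 := (max_lt_iff.1 ht1)
    have h1 := hloc t ht2.ne (by rw [abs_lt]; constructor <;> linarith)
    have h2 := hpos t ht3.1.le ht2
    by_contra hd0
    push Not at hd0
    have h3 : 0 ≤ ρ t * d * (z - t) := by
      have : 0 ≤ z - t := by linarith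
      positivity
    nlinarith
  obtain ⟨c, hc1, hc2⟩ := exists_between (lt_min hzq (by linarith : z < z + ε))
  have hc3 := lt_min_iff.1 hc2
  refine ⟨z, c, hvz, hc1, hc3.1, hz.2, hpos, fun t ht htc => ?_⟩
  have h1 := hloc t ht.ne' (by rw [abs_lt]; constructor <;> linarith)
  by_contra h0
  push Not at h0
  have h3 : 0 ≤ ρ t * (-d) * (t - z) := by
    have : 0 ≤ t - z := by linarith
    have : 0 ≤ -d := by linarith
    positivity
  nlinarith

theorem isoX_nonneg {ρ : ℝ → ℝ} {p q : ℝ} {w : ℝ × ℝ × ℝ × ℝ × ℝ × ℝ} (h : w ∈ isoX ρ p q) :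
    0 ≤ ρ w.2.2.1 := by
  obtain ⟨a, b, c, x, y, z⟩ := w
  rw [isoX_mem] at h
  rw [← h.2.2.2]
  positivity

theorem isoX_shrink {ρ : ℝ → ℝ} {p q p' q' : ℝ} (hp : p ≤ p') (hq : q' ≤ q)
    (h : ∀ z, p ≤ z → z ≤ q → 0 ≤ ρ z → p' ≤ z ∧ z ≤ q') : isoX ρ p q = isoX ρ p' q' := by
  ext w
  have hn : w ∈ isoX ρ p q → 0 ≤ ρ w.2.2.1 := isoX_nonneg
  obtain ⟨a, b, c, x, y, z⟩ := w
  rw [isoX_mem] at hn ⊢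
  rw [isoX_mem]
  constructor
  · intro hw
    exact ⟨hw.1, h c hw.2.1.1 hw.2.1.2 (hn hw), hw.2.2⟩
  · intro hw
    exact ⟨hw.1, ⟨hp.trans hw.2.1.1, hw.2.1.2.trans hq⟩, hw.2.2⟩

theorem isoX_cut {ρ : ℝ → ℝ} {p q c : ℝ} (hp : p ≤ c) (hq : c ≤ q) (hc : ρ c < 0) :
    Nonempty (isoX ρ p q ≃ₜ (isoX ρ p c ⊕ isoX ρ c q)) := by
  refine iso_split _ _ _ (fun w => w.2.2.1) (by fun_prop) c ?_ ?_ ?_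
  · intro w hw e
    have := isoX_nonneg hw
    rw [e] at this
    linarith
  · rintro ⟨a, b, t, x, y, z⟩
    rw [isoX_mem, isoX_mem]
    exact ⟨fun h => ⟨⟨h.1, ⟨h.2.1.1, h.2.1.2.trans hq⟩, h.2.2⟩, h.2.1.2⟩,
      fun h => ⟨h.1.1, ⟨h.1.2.1.1, h.2⟩, h.1.2.2⟩⟩
  · rintro ⟨a, b, t, x, y, z⟩
    rw [isoX_mem, isoX_mem]
    exact ⟨fun h => ⟨⟨h.1, ⟨hp.trans h.2.1.1, h.2.1.2⟩, h.2.2⟩, h.2.1.1⟩,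
      fun h => ⟨h.1.1, ⟨h.2, h.1.2.1.2⟩, h.1.2.2⟩⟩

theorem isoX_middle {ρ : ℝ → ℝ} (h : iso_reg ρ) (n : ℕ) : ∀ p q : ℝ, -1 ≤ p → q ≤ 1 → p ≤ q →
    ρ p < 0 → ρ q < 0 → {z ∈ Icc p q | ρ z = 0}.ncard ≤ n → iso_good (isoX ρ p q) 0 := by
  induction n with
  | zero =>
    intro p q hp hq hpq hp0 hq0 hn
    have hfin : {z ∈ Icc p q | ρ z = 0}.Finite :=
      (iso_reg_finite h).subset fun z hz => ⟨Icc_subset_Icc hp hq hz.1, hz.2⟩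
    have he := (Set.ncard_eq_zero hfin).1 (Nat.le_zero.1 hn)
    have : IsEmpty (isoX ρ p q) := by
      constructor
      rintro ⟨w, hw⟩
      have h0 := isoX_nonneg hw
      have hm : w.2.2.1 ∈ Icc p q := hw.2.1
      obtain ⟨s, hs, hs0⟩ := intermediate_value_Icc hm.1
        (h.1.mono (Icc_subset_Icc hp (hm.2.trans hq))) ⟨hp0.le, h0⟩
      have : s ∈ {z ∈ Icc p q | ρ z = 0} := ⟨⟨hs.1, hs.2.trans hm.2⟩, hs0⟩
      rw [he] at this
      exact this
    exact iso_good_empty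
  | succ n ih =>
    intro p q hp hq hpq hp0 hq0 hn
    have hfin : {z ∈ Icc p q | ρ z = 0}.Finite :=
      (iso_reg_finite h).subset fun z hz => ⟨Icc_subset_Icc hp hq hz.1, hz.2⟩
    by_cases hex : ∃ z ∈ Icc p q, ρ z = 0
    swap
    · apply ih p q hp hq hpq hp0 hq0
      have he : {z ∈ Icc p q | ρ z = 0} = ∅ := by
        ext z
        simp only [mem_empty_iff_false, iff_false]
        exact fun hz => hex ⟨z, hz⟩
      rw [he]
      simp
    obtain ⟨z1, v, h1, h2, h3, h4, h5, h6⟩ := iso_nz (iso_reg_neg h) p q hp hq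
      (neg_pos.2 hp0) (neg_ne_zero.2 hq0.ne) (by simpa using hex)
    have h4' : ρ z1 = 0 := neg_eq_zero.1 h4
    have hv0 : 0 < ρ v := neg_neg_iff_pos.1 (h6 v h2 le_rfl)
    have hex2 : ∃ z ∈ Icc v q, ρ z = 0 := by
      obtain ⟨s, hs, hs0⟩ := intermediate_value_Icc' h3.le
        (h.1.mono (Icc_subset_Icc (by linarith) hq)) ⟨hq0.le, hv0.le⟩
      exact ⟨s, hs, hs0⟩
    obtain ⟨z2, c, k1, k2, k3, k4, k5, k6⟩ := iso_nz h v q (by linarith) hq hv0 hq0.ne hex2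
    have hc0 : ρ c < 0 := k6 c k2 le_rfl
    have hset : isoX ρ p c = isoX ρ z1 z2 := by
      refine isoX_shrink h1.le k2.le fun z hz1 hz2 hz0 => ⟨?_, ?_⟩
      · by_contra hlt
        have : 0 < - ρ z := h5 z hz1 (not_le.1 hlt)
        linarith
      · by_contra hlt
        have := k6 z (not_le.1 hlt) hz2
        linarith
    have hA : iso_good (isoX ρ p c) 0 := by
      rw [hset]
      refine iso_good_S12 (isoX_S12 ρ z1 z2 (by linarith) (by linarith) (by linarith)
        (h.1.mono (Icc_subset_Icc (by linarith) (by linarith))) h4' k4 fun z hz1 hz2 => ?_)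
      rcases le_total z v with hzv | hzv
      · exact neg_neg_iff_pos.1 (h6 z hz1 hzv)
      · exact k5 z hzv hz2
    have hB : iso_good (isoX ρ c q) 0 := by
      refine ih c q (by linarith) hq k3.le hc0 hq0 ?_
      have hlt : {z ∈ Icc c q | ρ z = 0}.ncard < {z ∈ Icc p q | ρ z = 0}.ncard := by
        refine Set.ncard_lt_ncard ⟨fun z hz => ⟨⟨by linarith [hz.1.1], hz.1.2⟩, hz.2⟩, fun hsub => ?_⟩ hfin
        have := (hsub (⟨⟨h1.le, by linarith⟩, h4'⟩ : z1 ∈ {z ∈ Icc p q | ρ z = 0})).1.1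
        linarith
      omega
    exact iso_good_add (isoX_cut (by linarith) k3.le hc0) hA hB

theorem isoX_cap {ρ : ℝ → ℝ} (h : iso_reg ρ) (z c : ℝ) (h1 : -1 < z) (h2 : z < c) (h3 : c ≤ 1)
    (h0 : ρ z = 0) (h4 : ∀ t, -1 ≤ t → t < z → 0 < ρ t) (h5 : ∀ t, z < t → t ≤ c → ρ t < 0) :
    iso_good (isoX ρ (-1) c) 1 := by
  have hset : isoX ρ (-1) c = isoX ρ (-1) z := by
    refine isoX_shrink le_rfl h2.le fun t ht1 ht2 ht0 => ⟨ht1, ?_⟩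
    by_contra hlt
    have := h5 t (not_le.1 hlt) ht2
    linarith
  rw [hset]
  exact iso_good_S3 (isoX_S3 ρ z h1 (by linarith)
    (h.1.mono (Icc_subset_Icc le_rfl (by linarith))) h0 h4)

theorem isoX_left {ρ : ℝ → ℝ} (h : iso_reg ρ) (q : ℝ) (hq1 : -1 ≤ q) (hq : q ≤ 1)
    (hq0 : ρ q < 0) : iso_good (isoX ρ (-1) q) 1 := by
  rcases lt_trichotomy (ρ (-1)) 0 with hm | hm | hm
  · obtain ⟨n, k, hk, e⟩ := isoX_middle h _ (-1) q le_rfl hq hq1 hm hq0 le_rfl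
    exact ⟨n, k, hk.trans zero_le_one, e⟩
  · exact absurd rfl (h.2 (-1) ⟨le_rfl, by norm_num⟩ hm).1
  · have hex : ∃ z ∈ Icc (-1) q, ρ z = 0 := by
      obtain ⟨s, hs, hs0⟩ := intermediate_value_Icc' hq1
        (h.1.mono (Icc_subset_Icc le_rfl hq)) ⟨hq0.le, hm.le⟩
      exact ⟨s, hs, hs0⟩
    obtain ⟨z, c, k1, k2, k3, k4, k5, k6⟩ := iso_nz h (-1) q le_rfl hq hm hq0.ne hex
    have hc0 : ρ c < 0 := k6 c k2 le_rfl
    exact iso_good_add (isoX_cut (by linarith) k3.le hc0)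
      (isoX_cap h z c k1 k2 (by linarith) k4 k5 k6)
      (isoX_middle h _ c q (by linarith) hq k3.le hc0 hq0 le_rfl)

theorem isoX_model {ρ : ℝ → ℝ} (h : iso_reg ρ) :
    Nonempty (isoX ρ (-1) 1 ≃ₜ RP3) ∨ iso_good (isoX ρ (-1) 1) 2 := by
  rcases lt_trichotomy (ρ 1) 0 with hm | hm | hm
  · right
    obtain ⟨n, k, hk, e⟩ := isoX_left h 1 (by norm_num) le_rfl hm
    exact ⟨n, k, hk.trans one_le_two, e⟩
  · exact absurd rfl (h.2 1 ⟨by norm_num, le_rfl⟩ hm).2.1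
  · by_cases hex : ∃ z ∈ Icc (-1 : ℝ) 1, ρ z = 0
    · right
      have hr := iso_reg_reflect h
      obtain ⟨z0, hz0, hz00⟩ := hex
      obtain ⟨z, c, k1, k2, k3, k4, k5, k6⟩ := iso_nz hr (-1) 1 le_rfl le_rfl (by simpa using hm)
        (fun e => (h.2 (-1) ⟨le_rfl, by norm_num⟩ e).1 rfl)
        ⟨-z0, ⟨by linarith [hz0.2], by linarith [hz0.1]⟩, by simpa using hz00⟩
      have hc0 : ρ (-c) < 0 := k6 c k2 le_rfl
      obtain ⟨e⟩ := isoX_reflect ρ (-1) 1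
      rw [neg_neg] at e
      refine iso_good_congr e ?_
      refine iso_good_add (m := 1) (k := 1) (isoX_cut (by linarith) k3.le hc0)
        (isoX_cap hr z c k1 k2 (by linarith) k4 k5 k6) ?_
      obtain ⟨e2⟩ := isoX_reflect (fun z => ρ (-z)) c 1
      have hset : isoX (fun z => (fun z => ρ (-z)) (-z)) (-1) (-c) = isoX ρ (-1) (-c) := by
        simp only [neg_neg]
      exact iso_good_congr (e2.trans (Homeomorph.setCongr hset)) (isoX_left h (-c) (by linarith) (by linarith) hc0)
    · left
      refine isoX_RP3 ρ h.1 fun z hz => ?_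
      by_contra hneg
      obtain ⟨s, hs, hs0⟩ := intermediate_value_Icc hz.2
        (h.1.mono (Icc_subset_Icc hz.1 le_rfl)) ⟨not_lt.1 hneg, hm.le⟩
      exact hex ⟨s, ⟨hz.1.trans hs.1, hs.2⟩, hs0⟩


/-- Third coordinate of R as a function of the height on the sphere. -/
def iso_xi (r b z : ℝ) : ℝ := r * z / √(b ^ 2 * (1 - z ^ 2) + z ^ 2)

theorem iso_E_pos {b z : ℝ} (hb : 0 < b) (hz : -1 ≤ z ∧ z ≤ 1) :
    0 < b ^ 2 * (1 - z ^ 2) + z ^ 2 := by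
  have h1 : z ^ 2 ≤ 1 := by nlinarith [hz.1, hz.2]
  by_cases h0 : z = 0
  · rw [h0]; norm_num; positivity
  · have : 0 < z ^ 2 := by positivity
    have : 0 ≤ b ^ 2 * (1 - z ^ 2) := mul_nonneg (by positivity) (by linarith)
    linarith

theorem iso_D_pos {r b x : ℝ} (hr : 0 < r) (hb : 0 < b) (hx : x ^ 2 ≤ r ^ 2) :
    0 < r ^ 2 - x ^ 2 + b ^ 2 * x ^ 2 := by
  by_cases h0 : x = 0
  · rw [h0]; norm_num; positivity
  · have : 0 < b ^ 2 * x ^ 2 := by positivity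
    linarith

theorem iso_xi_sq {r b z : ℝ} (hb : 0 < b) (hz : -1 ≤ z ∧ z ≤ 1) :
    iso_xi r b z ^ 2 ≤ r ^ 2 := by
  have hE := iso_E_pos hb hz
  have h1 : z ^ 2 ≤ 1 := by nlinarith [hz.1, hz.2]
  rw [iso_xi, div_pow, Real.sq_sqrt hE.le, div_le_iff₀ hE]
  have : 0 ≤ r ^ 2 * (b ^ 2 * (1 - z ^ 2)) := by
    have : 0 ≤ 1 - z ^ 2 := by linarith
    positivity
  nlinarith

theorem iso_sqrtD {r b z : ℝ} (hr : 0 < r) (hb : 0 < b) (hz : -1 ≤ z ∧ z ≤ 1) :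
    √(r ^ 2 - iso_xi r b z ^ 2 + b ^ 2 * iso_xi r b z ^ 2) =
      r * b / √(b ^ 2 * (1 - z ^ 2) + z ^ 2) := by
  have hE := iso_E_pos hb hz
  have hs := Real.sqrt_pos.2 hE
  have hs2 := Real.sq_sqrt hE.le
  rw [← Real.sqrt_sq (by positivity : 0 ≤ r * b / √(b ^ 2 * (1 - z ^ 2) + z ^ 2))]
  congr 1
  unfold iso_xi
  rw [div_pow, div_pow, hs2]
  field_simp
  ring

theorem iso_sqrtE {r b x : ℝ} (hr : 0 < r) (hb : 0 < b) (hx : x ^ 2 ≤ r ^ 2) :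
    √(b ^ 2 * (1 - (b * x / √(r ^ 2 - x ^ 2 + b ^ 2 * x ^ 2)) ^ 2) +
      (b * x / √(r ^ 2 - x ^ 2 + b ^ 2 * x ^ 2)) ^ 2) = b * r / √(r ^ 2 - x ^ 2 + b ^ 2 * x ^ 2) := by
  have hD := iso_D_pos hr hb hx
  have hs := Real.sqrt_pos.2 hD
  have hs2 := Real.sq_sqrt hD.le
  rw [← Real.sqrt_sq (by positivity : 0 ≤ b * r / √(r ^ 2 - x ^ 2 + b ^ 2 * x ^ 2))]
  congr 1
  rw [div_pow, div_pow, hs2]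
  field_simp
  ring

theorem iso_xi_inv {r b x : ℝ} (hr : 0 < r) (hb : 0 < b) (hx : x ^ 2 ≤ r ^ 2) :
    iso_xi r b (b * x / √(r ^ 2 - x ^ 2 + b ^ 2 * x ^ 2)) = x := by
  have hD := iso_D_pos hr hb hx
  have hs := Real.sqrt_pos.2 hD
  rw [iso_xi, iso_sqrtE hr hb hx]
  field_simp

/-- The isoenergy surface in completed-square form. -/
def isoA (r b g : ℝ) (γ τ κ ρ : ℝ → ℝ) : Set E6 :=
  {y | (y 3) ^ 2 + (y 4) ^ 2 + (y 5) ^ 2 = r ^ 2 ∧ y 0 * y 3 + y 1 * y 4 + y 2 * y 5 = g ∧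
    (y 0 - τ (y 5) * y 3 + γ (y 5) * y 4) ^ 2 + (y 1 - τ (y 5) * y 4 - γ (y 5) * y 3) ^ 2 +
      (y 2 / b - b * κ (y 5)) ^ 2 = ρ (y 5)}

theorem isoA_homeo (r b g : ℝ) (hr : 0 < r) (hb : 0 < b) (γ τ κ ρ : ℝ → ℝ)
    (cγ : ContinuousOn γ {x | x ^ 2 ≤ r ^ 2}) (cτ : ContinuousOn τ {x | x ^ 2 ≤ r ^ 2})
    (cκ : ContinuousOn κ {x | x ^ 2 ≤ r ^ 2})
    (hκ : ∀ x, x ^ 2 ≤ r ^ 2 → τ x * (r ^ 2 - x ^ 2) + b ^ 2 * x * κ x = g) :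
    Nonempty (isoA r b g γ τ κ ρ ≃ₜ isoX (fun z => ρ (iso_xi r b z)) (-1) 1) := by
  have hA : ∀ y ∈ isoA r b g γ τ κ ρ, (y 5) ^ 2 ≤ r ^ 2 := by
    intro y hy
    have := hy.1
    nlinarith [sq_nonneg (y 3), sq_nonneg (y 4)]
  refine ⟨iso_mk _ _
    (fun y => (y 3 / √(r ^ 2 - (y 5) ^ 2 + b ^ 2 * (y 5) ^ 2),
      y 4 / √(r ^ 2 - (y 5) ^ 2 + b ^ 2 * (y 5) ^ 2),
      b * y 5 / √(r ^ 2 - (y 5) ^ 2 + b ^ 2 * (y 5) ^ 2),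
      y 0 - τ (y 5) * y 3 + γ (y 5) * y 4, y 1 - τ (y 5) * y 4 - γ (y 5) * y 3,
      y 2 / b - b * κ (y 5)))
    (fun w =>
      ![w.2.2.2.1 + τ (iso_xi r b w.2.2.1) * (r * b * w.1 / √(b ^ 2 * (1 - w.2.2.1 ^ 2) + w.2.2.1 ^ 2))
        - γ (iso_xi r b w.2.2.1) * (r * b * w.2.1 / √(b ^ 2 * (1 - w.2.2.1 ^ 2) + w.2.2.1 ^ 2)),
        w.2.2.2.2.1 + τ (iso_xi r b w.2.2.1) * (r * b * w.2.1 / √(b ^ 2 * (1 - w.2.2.1 ^ 2) + w.2.2.1 ^ 2))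
        + γ (iso_xi r b w.2.2.1) * (r * b * w.1 / √(b ^ 2 * (1 - w.2.2.1 ^ 2) + w.2.2.1 ^ 2)),
        b * (w.2.2.2.2.2 + b * κ (iso_xi r b w.2.2.1)),
        r * b * w.1 / √(b ^ 2 * (1 - w.2.2.1 ^ 2) + w.2.2.1 ^ 2),
        r * b * w.2.1 / √(b ^ 2 * (1 - w.2.2.1 ^ 2) + w.2.2.1 ^ 2),
        iso_xi r b w.2.2.1]) ?_ ?_ ?_ ?_ ?_ ?_⟩
  · have h0 : ∀ y ∈ isoA r b g γ τ κ ρ, √(r ^ 2 - (y 5) ^ 2 + b ^ 2 * (y 5) ^ 2) ≠ 0 :=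
      fun y hy => (Real.sqrt_pos.2 (iso_D_pos hr hb (hA y hy))).ne'
    have c5 : ContinuousOn (fun y : E6 => y 5) (isoA r b g γ τ κ ρ) := by fun_prop
    have c1 : ContinuousOn (fun y : E6 => τ (y 5)) (isoA r b g γ τ κ ρ) := cτ.comp c5 hA
    have c2 : ContinuousOn (fun y : E6 => γ (y 5)) (isoA r b g γ τ κ ρ) := cγ.comp c5 hA
    have c3 : ContinuousOn (fun y : E6 => κ (y 5)) (isoA r b g γ τ κ ρ) := cκ.comp c5 hA
    fun_prop (disch := assumption)
  · have h0 : ∀ w ∈ isoX (fun z => ρ (iso_xi r b z)) (-1) 1,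
        √(b ^ 2 * (1 - w.2.2.1 ^ 2) + w.2.2.1 ^ 2) ≠ 0 :=
      fun w hw => (Real.sqrt_pos.2 (iso_E_pos hb hw.2.1)).ne'
    have hm : ∀ w ∈ isoX (fun z => ρ (iso_xi r b z)) (-1) 1, (iso_xi r b w.2.2.1) ^ 2 ≤ r ^ 2 :=
      fun w hw => iso_xi_sq hb hw.2.1
    have c5 : ContinuousOn (fun w : ℝ × ℝ × ℝ × ℝ × ℝ × ℝ => iso_xi r b w.2.2.1)
        (isoX (fun z => ρ (iso_xi r b z)) (-1) 1) := by
      unfold iso_xi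
      fun_prop (disch := assumption)
    have c1 : ContinuousOn (fun w : ℝ × ℝ × ℝ × ℝ × ℝ × ℝ => τ (iso_xi r b w.2.2.1))
      (isoX (fun z => ρ (iso_xi r b z)) (-1) 1) := cτ.comp c5 hm
    have c2 : ContinuousOn (fun w : ℝ × ℝ × ℝ × ℝ × ℝ × ℝ => γ (iso_xi r b w.2.2.1))
      (isoX (fun z => ρ (iso_xi r b z)) (-1) 1) := cγ.comp c5 hm
    have c3 : ContinuousOn (fun w : ℝ × ℝ × ℝ × ℝ × ℝ × ℝ => κ (iso_xi r b w.2.2.1))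
      (isoX (fun z => ρ (iso_xi r b z)) (-1) 1) := cκ.comp c5 hm
    rw [continuousOn_pi]
    intro i
    fin_cases i
    · simp only [Fin.zero_eta, Matrix.cons_val_zero]
      fun_prop (disch := assumption)
    · simp
      fun_prop (disch := assumption)
    · simp
      fun_prop (disch := assumption)
    · simp
      fun_prop (disch := assumption)
    · simp
      fun_prop (disch := assumption)
    · simp
      fun_prop (disch := assumption)
  · intro y hy
    have hx := hA y hy
    have hD := iso_D_pos hr hb hx
    have hs := Real.sqrt_pos.2 hD
    have hs2 := Real.sq_sqrt hD.le
    have e1 := hκ _ hx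
    have hxi := iso_xi_inv hr hb hx
    obtain ⟨h1, h2, h3⟩ := hy
    rw [isoX_mem]
    have k1 : (y 3 / √(r ^ 2 - (y 5) ^ 2 + b ^ 2 * (y 5) ^ 2)) ^ 2 +
      (y 4 / √(r ^ 2 - (y 5) ^ 2 + b ^ 2 * (y 5) ^ 2)) ^ 2 +
      (b * y 5 / √(r ^ 2 - (y 5) ^ 2 + b ^ 2 * (y 5) ^ 2)) ^ 2 = 1 := by
      rw [div_pow, div_pow, div_pow, hs2, ← add_div, ← add_div, div_eq_one_iff_eq hD.ne']
      linear_combination h1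
    refine ⟨k1, ⟨?_, ?_⟩, ?_, ?_⟩
    · refine (abs_le.1 (abs_le_one_iff_mul_self_le_one.2 ?_)).1
      rw [← pow_two, ← k1]
      have := sq_nonneg (y 3 / √(r ^ 2 - (y 5) ^ 2 + b ^ 2 * (y 5) ^ 2))
      have := sq_nonneg (y 4 / √(r ^ 2 - (y 5) ^ 2 + b ^ 2 * (y 5) ^ 2))
      linarith
    · refine (abs_le.1 (abs_le_one_iff_mul_self_le_one.2 ?_)).2
      rw [← pow_two, ← k1]
      have := sq_nonneg (y 3 / √(r ^ 2 - (y 5) ^ 2 + b ^ 2 * (y 5) ^ 2))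
      have := sq_nonneg (y 4 / √(r ^ 2 - (y 5) ^ 2 + b ^ 2 * (y 5) ^ 2))
      linarith
    · have e : y 3 * (y 0 - τ (y 5) * y 3 + γ (y 5) * y 4) +
          y 4 * (y 1 - τ (y 5) * y 4 - γ (y 5) * y 3) + b * y 5 * (y 2 / b - b * κ (y 5)) = 0 := by
        have : b * y 5 * (y 2 / b - b * κ (y 5)) = y 5 * y 2 - b ^ 2 * y 5 * κ (y 5) := by
          field_simp
        rw [this]
        linear_combination h2 - e1 - τ (y 5) * h1
      rw [div_mul_eq_mul_div, div_mul_eq_mul_div, div_mul_eq_mul_div, ← add_div, ← add_div, e, zero_div]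
    · rw [hxi]
      exact h3
  · rintro ⟨n1, n2, z, u, v, w⟩ hw
    rw [isoX_mem] at hw
    obtain ⟨h1, h2, h3, h4⟩ := hw
    have hE := iso_E_pos hb h2
    have hs := Real.sqrt_pos.2 hE
    have hs2 := Real.sq_sqrt hE.le
    have hx := iso_xi_sq (r := r) hb h2
    have e1 := hκ _ hx
    have hxs : iso_xi r b z = r * z / √(b ^ 2 * (1 - z ^ 2) + z ^ 2) := rfl
    generalize √(b ^ 2 * (1 - z ^ 2) + z ^ 2) = E at *
    have k1 : (r * b * n1 / E) ^ 2 + (r * b * n2 / E) ^ 2 + (iso_xi r b z) ^ 2 = r ^ 2 := by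
      rw [hxs, div_pow, div_pow, div_pow, hs2]
      field_simp
      linear_combination b ^ 2 * h1
    have k0 : (r * b / E) * (n1 * u + n2 * v + z * w) = 0 := by rw [h3, mul_zero]
    have k3 : b * w * iso_xi r b z = (r * b / E) * (z * w) := by rw [hxs]; field_simp
    refine ⟨k1, ?_, ?_⟩
    · simp
      linear_combination e1 + τ (iso_xi r b z) * k1 + k3 + k0
    · simp
      rw [show b * (w + b * κ (iso_xi r b z)) / b - b * κ (iso_xi r b z) = w by field_simp; ring]
      linear_combination h4
  · intro y hy
    have hx := hA y hy
    have hD := iso_D_pos hr hb hx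
    have hs := Real.sqrt_pos.2 hD
    simp only
    rw [iso_xi_inv hr hb hx, iso_sqrtE hr hb hx]
    generalize √(r ^ 2 - (y 5) ^ 2 + b ^ 2 * (y 5) ^ 2) = D at *
    have k3 : r * b * (y 3 / D) / (b * r / D) = y 3 := by field_simp
    have k4 : r * b * (y 4 / D) / (b * r / D) = y 4 := by field_simp
    rw [k3, k4]
    ext i
    fin_cases i
    · simp; ring
    · simp; ring
    · simp; field_simp
    · simp
    · simp
    · simp
  · rintro ⟨n1, n2, z, u, v, w⟩ hw
    rw [isoX_mem] at hw
    obtain ⟨h1, h2, h3, h4⟩ := hw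
    have hE := iso_E_pos hb h2
    have hs := Real.sqrt_pos.2 hE
    have hxs : iso_xi r b z = r * z / √(b ^ 2 * (1 - z ^ 2) + z ^ 2) := rfl
    have hD := iso_sqrtD hr hb h2
    simp
    rw [hD]
    refine ⟨by field_simp, by field_simp, by rw [hxs]; field_simp, by ring, by ring, by field_simp; ring⟩


/-- Reduced potential. -/
def iso_Phi (b : ℝ) (g₁ g₂ g₃ V : ℝ → ℝ → ℝ) (p : ℝ × ℝ × ℝ) : ℝ :=
  V p.1 p.2.2 + g₂ p.1 p.2.2 * p.2.1
    - (1 / 2) * ((g₁ p.1 p.2.2) ^ 2 * (p.1 - p.2.2 ^ 2) + b ^ 2 * (g₃ p.1 p.2.2) ^ 2)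
    + (1 / 2) * ((p.2.1 + b ^ 2 * g₃ p.1 p.2.2 * p.2.2) ^ 2 / (p.1 - p.2.2 ^ 2 + b ^ 2 * p.2.2 ^ 2))

/-- The multiplier. -/
def iso_tau (b : ℝ) (g₃ : ℝ → ℝ → ℝ) (a g x : ℝ) : ℝ :=
  (g + b ^ 2 * g₃ a x * x) / (a - x ^ 2 + b ^ 2 * x ^ 2)

theorem iso_H_eq (b : ℝ) (hb : 0 < b) (g₁ g₂ g₃ V : ℝ → ℝ → ℝ) (y : E6) (a g : ℝ)
    (ha : (y 3) ^ 2 + (y 4) ^ 2 + (y 5) ^ 2 = a) (hg : y 0 * y 3 + y 1 * y 4 + y 2 * y 5 = g)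
    (hD : a - (y 5) ^ 2 + b ^ 2 * (y 5) ^ 2 ≠ 0) :
    H4 (b ^ 2) g₁ g₂ g₃ V y = (1 / 2) *
      ((y 0 - iso_tau b g₃ a g (y 5) * y 3 + g₁ a (y 5) * y 4) ^ 2 +
       (y 1 - iso_tau b g₃ a g (y 5) * y 4 - g₁ a (y 5) * y 3) ^ 2 +
       (y 2 / b - b * (iso_tau b g₃ a g (y 5) * y 5 - g₃ a (y 5))) ^ 2) +
      iso_Phi b g₁ g₂ g₃ V (a, g, y 5) := by
  have hτ : iso_tau b g₃ a g (y 5) * (a - (y 5) ^ 2 + b ^ 2 * (y 5) ^ 2) =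
      g + b ^ 2 * g₃ a (y 5) * y 5 := by
    unfold iso_tau; field_simp
  have h2 : (g + b ^ 2 * g₃ a (y 5) * y 5) ^ 2 / (a - (y 5) ^ 2 + b ^ 2 * (y 5) ^ 2) =
      iso_tau b g₃ a g (y 5) ^ 2 * (a - (y 5) ^ 2 + b ^ 2 * (y 5) ^ 2) := by
    rw [← hτ]; field_simp
  unfold H4 iso_Phi
  simp only
  rw [ha, hg, h2]
  generalize iso_tau b g₃ a g (y 5) = t at *
  generalize g₁ a (y 5) = c1 at *
  generalize g₃ a (y 5) = c3 at *
  have e3 : (y 2 / b - b * (t * y 5 - c3)) ^ 2 = y 2 ^ 2 / b ^ 2 - 2 * y 2 * (t * y 5 - c3)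
      + b ^ 2 * (t * y 5 - c3) ^ 2 := by
    field_simp
    ring
  rw [e3]
  linear_combination (-1 / 2 * c1 ^ 2 - 1 / 2 * t ^ 2) * ha + t * hg - t * hτ

theorem iso_Phi_diff (b : ℝ) (g₁ g₂ g₃ V : ℝ → ℝ → ℝ)
    (hg₁ : ContDiff ℝ (⊤ : ℕ∞) (Function.uncurry g₁))
    (hg₂ : ContDiff ℝ (⊤ : ℕ∞) (Function.uncurry g₂))
    (hg₃ : ContDiff ℝ (⊤ : ℕ∞) (Function.uncurry g₃))
    (hV : ContDiff ℝ (⊤ : ℕ∞) (Function.uncurry V)) (p : ℝ × ℝ × ℝ)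
    (hD : p.1 - p.2.2 ^ 2 + b ^ 2 * p.2.2 ^ 2 ≠ 0) :
    DifferentiableAt ℝ (iso_Phi b g₁ g₂ g₃ V) p := by
  have key : ∀ f : ℝ → ℝ → ℝ, ContDiff ℝ (⊤ : ℕ∞) (Function.uncurry f) →
      DifferentiableAt ℝ (fun p : ℝ × ℝ × ℝ => f p.1 p.2.2) p := by
    intro f hf
    have h1 : Differentiable ℝ (Function.uncurry f) := hf.differentiable (by simp)
    have h2 : DifferentiableAt ℝ (fun p : ℝ × ℝ × ℝ => (p.1, p.2.2)) p := by fun_prop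
    exact (h1 _).comp p h2
  have k1 := key _ hg₁
  have k2 := key _ hg₂
  have k3 := key _ hg₃
  have k4 := key _ hV
  have aux : ∀ v w1 w2 w3 : ℝ × ℝ × ℝ → ℝ, DifferentiableAt ℝ v p → DifferentiableAt ℝ w1 p →
      DifferentiableAt ℝ w2 p → DifferentiableAt ℝ w3 p →
      DifferentiableAt ℝ (fun p : ℝ × ℝ × ℝ => v p + w2 p * p.2.1
        - (1 / 2) * ((w1 p) ^ 2 * (p.1 - p.2.2 ^ 2) + b ^ 2 * (w3 p) ^ 2)
        + (1 / 2) * ((p.2.1 + b ^ 2 * w3 p * p.2.2) ^ 2 /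
          (p.1 - p.2.2 ^ 2 + b ^ 2 * p.2.2 ^ 2))) p := by
    intro v w1 w2 w3 _ _ _ _
    fun_prop (disch := assumption)
  exact aux _ _ _ _ k4 k1 k2 k3

theorem iso_H_diff (β : ℝ) (g₁ g₂ g₃ V : ℝ → ℝ → ℝ)
    (hg₁ : ContDiff ℝ (⊤ : ℕ∞) (Function.uncurry g₁))
    (hg₂ : ContDiff ℝ (⊤ : ℕ∞) (Function.uncurry g₂))
    (hg₃ : ContDiff ℝ (⊤ : ℕ∞) (Function.uncurry g₃))
    (hV : ContDiff ℝ (⊤ : ℕ∞) (Function.uncurry V)) (y : E6) :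
    DifferentiableAt ℝ (H4 β g₁ g₂ g₃ V) y := by
  have key : ∀ f : ℝ → ℝ → ℝ, ContDiff ℝ (⊤ : ℕ∞) (Function.uncurry f) →
      DifferentiableAt ℝ (fun y : E6 => f ((y 3)^2 + (y 4)^2 + (y 5)^2) (y 5)) y := by
    intro f hf
    have h1 : Differentiable ℝ (Function.uncurry f) := hf.differentiable (by simp)
    have h2 : DifferentiableAt ℝ (fun y : E6 => ((y 3)^2 + (y 4)^2 + (y 5)^2, y 5)) y := by fun_prop
    exact (h1 _).comp y h2
  have k1 := key _ hg₁
  have k2 := key _ hg₂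
  have k3 := key _ hg₃
  have k4 := key _ hV
  have aux : ∀ v w1 w2 w3 : E6 → ℝ, DifferentiableAt ℝ v y → DifferentiableAt ℝ w1 y →
      DifferentiableAt ℝ w2 y → DifferentiableAt ℝ w3 y →
      DifferentiableAt ℝ (fun y : E6 => (1/2) * ((y 0)^2 + (y 1)^2 + (y 2)^2 / β)
        + w1 y * (y 0 * y 4 - y 1 * y 3) + w2 y * (y 0 * y 3 + y 1 * y 4 + y 2 * y 5)
        + w3 y * y 2 + v y) y := by
    intro v w1 w2 w3 _ _ _ _
    fun_prop
  exact aux _ _ _ _ k4 k1 k2 k3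

theorem iso_lin {E : Type*} [AddCommGroup E] [Module ℝ E] {u v w : E}
    (h : LinearIndependent ℝ ![u, v, w]) (s t : ℝ) (e : u = s • v + t • w) : False := by
  rw [Fintype.linearIndependent_iff] at h
  have := h ![1, -s, -t] (by
    rw [Fin.sum_univ_three]
    simp [e]) 0
  simp at this

theorem iso_crit (b : ℝ) (hb : 0 < b) (g₁ g₂ g₃ V : ℝ → ℝ → ℝ)
    (hg₁ : ContDiff ℝ (⊤ : ℕ∞) (Function.uncurry g₁))
    (hg₂ : ContDiff ℝ (⊤ : ℕ∞) (Function.uncurry g₂))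
    (hg₃ : ContDiff ℝ (⊤ : ℕ∞) (Function.uncurry g₃))
    (hV : ContDiff ℝ (⊤ : ℕ∞) (Function.uncurry V)) (y : E6) (a g : ℝ)
    (ha : (y 3) ^ 2 + (y 4) ^ 2 + (y 5) ^ 2 = a) (hg : y 0 * y 3 + y 1 * y 4 + y 2 * y 5 = g)
    (ha0 : 0 < a) (hD : 0 < a - (y 5) ^ 2 + b ^ 2 * (y 5) ^ 2)
    (hH : H4 (b ^ 2) g₁ g₂ g₃ V y = iso_Phi b g₁ g₂ g₃ V (a, g, y 5))
    (hl : LinearIndependent ℝ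
        ![fderiv ℝ (H4 (b ^ 2) g₁ g₂ g₃ V) y,
          fderiv ℝ (fun z : E6 => (z 3)^2 + (z 4)^2 + (z 5)^2) y,
          fderiv ℝ (fun z : E6 => z 0 * z 3 + z 1 * z 4 + z 2 * z 5) y]) :
    fderiv ℝ (iso_Phi b g₁ g₂ g₃ V) (a, g, y 5) (0, 0, 1) ≠ 0 ∧ (y 5) ^ 2 ≠ a := by
  let F1 : E6 → ℝ := fun z : E6 => (z 3)^2 + (z 4)^2 + (z 5)^2
  let F2 : E6 → ℝ := fun z : E6 => z 0 * z 3 + z 1 * z 4 + z 2 * z 5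
  let F3 : E6 → ℝ := fun z : E6 => z 5
  let G : E6 → ℝ × ℝ × ℝ := fun z => (F1 z, F2 z, F3 z)
  have hG0 : G y = (a, g, y 5) := by
    show (F1 y, F2 y, F3 y) = _
    rw [← ha, ← hg]
  have d1 : DifferentiableAt ℝ F1 y := by unfold F1; fun_prop
  have d2 : DifferentiableAt ℝ F2 y := by unfold F2; fun_prop
  have d3 : DifferentiableAt ℝ F3 y := by unfold F3; fun_prop
  have dG : HasFDerivAt G ((fderiv ℝ F1 y).prod ((fderiv ℝ F2 y).prod (fderiv ℝ F3 y))) y :=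
    d1.hasFDerivAt.prodMk (d2.hasFDerivAt.prodMk d3.hasFDerivAt)
  have dP : DifferentiableAt ℝ (iso_Phi b g₁ g₂ g₃ V) (a, g, y 5) :=
    iso_Phi_diff b g₁ g₂ g₃ V hg₁ hg₂ hg₃ hV _ hD.ne'
  obtain ⟨L, hL⟩ : ∃ L, L = fderiv ℝ (iso_Phi b g₁ g₂ g₃ V) (a, g, y 5) := ⟨_, rfl⟩
  have dP' : HasFDerivAt (iso_Phi b g₁ g₂ g₃ V) L (G y) := by
    rw [hG0, hL]; exact dP.hasFDerivAt
  have dPG := dP'.comp y dG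
  have dH := (iso_H_diff (b ^ 2) g₁ g₂ g₃ V hg₁ hg₂ hg₃ hV y).hasFDerivAt
  have hmin : IsLocalMin (fun z => H4 (b ^ 2) g₁ g₂ g₃ V z - (iso_Phi b g₁ g₂ g₃ V ∘ G) z) y := by
    have hcont : Continuous (fun z : E6 => F1 z - (z 5) ^ 2 + b ^ 2 * (z 5) ^ 2) := by
      unfold F1; fun_prop
    have hpos : ∀ᶠ z in 𝓝 y, 0 < F1 z - (z 5) ^ 2 + b ^ 2 * (z 5) ^ 2 :=
      hcont.continuousAt.eventually (lt_mem_nhds (by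
        show 0 < F1 y - (y 5) ^ 2 + b ^ 2 * (y 5) ^ 2
        have : F1 y = a := ha
        rw [this]; exact hD))
    filter_upwards [hpos] with z hz
    have e := iso_H_eq b hb g₁ g₂ g₃ V z (F1 z) (F2 z) rfl rfl hz.ne'
    show H4 (b ^ 2) g₁ g₂ g₃ V y - iso_Phi b g₁ g₂ g₃ V (G y) ≤
      H4 (b ^ 2) g₁ g₂ g₃ V z - iso_Phi b g₁ g₂ g₃ V (F1 z, F2 z, z 5)
    rw [hG0, hH, e, sub_self, add_sub_cancel_right]
    positivity
  have hz := hmin.hasFDerivAt_eq_zero (dH.sub dPG)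
  have hdH : fderiv ℝ (H4 (b ^ 2) g₁ g₂ g₃ V) y = L (1, 0, 0) • fderiv ℝ F1 y
      + L (0, 1, 0) • fderiv ℝ F2 y + L (0, 0, 1) • fderiv ℝ F3 y := by
    rw [sub_eq_zero.1 hz]
    ext1 v
    simp only [ContinuousLinearMap.comp_apply, ContinuousLinearMap.prod_apply,
      add_apply, smul_apply, smul_eq_mul]
    have : ((fderiv ℝ F1 y v, fderiv ℝ F2 y v, fderiv ℝ F3 y v) : ℝ × ℝ × ℝ) =
      fderiv ℝ F1 y v • (1, 0, 0) + fderiv ℝ F2 y v • (0, 1, 0) + fderiv ℝ F3 y v • (0, 0, 1) := by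
      simp
    rw [this, map_add, map_add, map_smul, map_smul, map_smul]
    simp only [smul_eq_mul]
    ring
  constructor
  · intro h0
    rw [← hL] at h0
    rw [h0, zero_smul, add_zero] at hdH
    exact iso_lin hl _ _ hdH
  · intro h5
    have h34 : (y 3) ^ 2 + (y 4) ^ 2 = 0 := by linarith
    have h3 : y 3 = 0 := by nlinarith [sq_nonneg (y 3), sq_nonneg (y 4)]
    have h4 : y 4 = 0 := by nlinarith [sq_nonneg (y 3), sq_nonneg (y 4)]
    have h50 : y 5 ≠ 0 := by rintro h; rw [h] at h5; norm_num at h5; linarith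
    have p : ∀ i : Fin 6, HasFDerivAt (fun z : E6 => z i) (ContinuousLinearMap.proj i : E6 →L[ℝ] ℝ) y :=
      fun i => hasFDerivAt_apply i y
    have hF1 := (((p 3).pow 2).add ((p 4).pow 2)).add ((p 5).pow 2)
    have e1 : fderiv ℝ F1 y = (2 * y 5) • fderiv ℝ F3 y := by
      rw [show fderiv ℝ F3 y = _ from (p 5).fderiv, show fderiv ℝ F1 y = _ from hF1.fderiv]
      simp [h3, h4]
    have e2 : fderiv ℝ F3 y = (2 * y 5)⁻¹ • fderiv ℝ F1 y := by
      rw [e1, smul_smul, inv_mul_cancel₀ (by positivity), one_smul]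
    refine iso_lin hl (L (1, 0, 0) + L (0, 0, 1) * (2 * y 5)⁻¹) (L (0, 1, 0)) ?_
    rw [hdH, e2, smul_smul, add_smul]
    show _ = _ • fderiv ℝ F1 y + _ • fderiv ℝ F1 y + _ • fderiv ℝ F2 y
    abel

theorem iso_xi_deriv {r b z : ℝ} (hr : 0 < r) (hb : 0 < b) (hz : -1 ≤ z ∧ z ≤ 1) :
    ∃ d, d ≠ 0 ∧ HasDerivAt (iso_xi r b) d z := by
  have hE := iso_E_pos hb hz
  have hs := Real.sqrt_pos.2 hE
  have hs2 := Real.sq_sqrt hE.le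
  have h1 : HasDerivAt (fun z : ℝ => b ^ 2 * (1 - z ^ 2) + z ^ 2) (-2 * b ^ 2 * z + 2 * z) z := by
    have := (((hasDerivAt_pow 2 z).const_sub 1).const_mul (b ^ 2)).add (hasDerivAt_pow 2 z)
    have e : b ^ 2 * -(((2 : ℕ) : ℝ) * z ^ (2 - 1)) + ((2 : ℕ) : ℝ) * z ^ (2 - 1) =
        -2 * b ^ 2 * z + 2 * z := by
      norm_num; ring
    rw [e] at this
    exact this
  have h2 := h1.sqrt hE.ne'
  have h3 := ((hasDerivAt_id z).const_mul r).div h2 hs.ne'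
  refine ⟨_, ?_, h3⟩
  apply ne_of_gt
  apply div_pos _ (by positivity)
  have : r * 1 * √(b ^ 2 * (1 - z ^ 2) + z ^ 2) - r * id z *
      ((-2 * b ^ 2 * z + 2 * z) / (2 * √(b ^ 2 * (1 - z ^ 2) + z ^ 2))) =
      r * b ^ 2 / √(b ^ 2 * (1 - z ^ 2) + z ^ 2) := by
    rw [id]
    field_simp
    rw [hs2]
    ring
  rw [this]
  positivity

theorem iso_final (b r g h : ℝ) (hb : 0 < b) (hr : 0 < r) (g₁ g₂ g₃ V : ℝ → ℝ → ℝ)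
    (hg₁ : ContDiff ℝ (⊤ : ℕ∞) (Function.uncurry g₁))
    (hg₂ : ContDiff ℝ (⊤ : ℕ∞) (Function.uncurry g₂))
    (hg₃ : ContDiff ℝ (⊤ : ℕ∞) (Function.uncurry g₃))
    (hV : ContDiff ℝ (⊤ : ℕ∞) (Function.uncurry V))
    (hreg : ∀ y : E6,
      (y 3)^2 + (y 4)^2 + (y 5)^2 = r ^ 2 →
      y 0 * y 3 + y 1 * y 4 + y 2 * y 5 = g →
      H4 (b ^ 2) g₁ g₂ g₃ V y = h →
      LinearIndependent ℝ
        ![fderiv ℝ (H4 (b ^ 2) g₁ g₂ g₃ V) y,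
          fderiv ℝ (fun z : E6 => (z 3)^2 + (z 4)^2 + (z 5)^2) y,
          fderiv ℝ (fun z : E6 => z 0 * z 3 + z 1 * z 4 + z 2 * z 5) y]) :
    Nonempty ({y : E6 | (y 3)^2 + (y 4)^2 + (y 5)^2 = r ^ 2 ∧
      y 0 * y 3 + y 1 * y 4 + y 2 * y 5 = g ∧ H4 (b ^ 2) g₁ g₂ g₃ V y = h} ≃ₜ RP3) ∨
    iso_good {y : E6 | (y 3)^2 + (y 4)^2 + (y 5)^2 = r ^ 2 ∧
      y 0 * y 3 + y 1 * y 4 + y 2 * y 5 = g ∧ H4 (b ^ 2) g₁ g₂ g₃ V y = h} 2 := by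
  obtain ⟨γ, hγ⟩ : ∃ γ : ℝ → ℝ, γ = fun x => g₁ (r ^ 2) x := ⟨_, rfl⟩
  obtain ⟨τ, hτ⟩ : ∃ τ : ℝ → ℝ, τ = fun x => iso_tau b g₃ (r ^ 2) g x := ⟨_, rfl⟩
  obtain ⟨κ, hκ⟩ : ∃ κ : ℝ → ℝ, κ = fun x => τ x * x - g₃ (r ^ 2) x := ⟨_, rfl⟩
  obtain ⟨ρ, hρ⟩ : ∃ ρ : ℝ → ℝ, ρ = fun x => 2 * (h - iso_Phi b g₁ g₂ g₃ V (r ^ 2, g, x)) :=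
    ⟨_, rfl⟩
  have key : ∀ f : ℝ → ℝ → ℝ, ContDiff ℝ (⊤ : ℕ∞) (Function.uncurry f) →
      Continuous (fun x => f (r ^ 2) x) := by
    intro f hf
    exact hf.continuous.comp (by fun_prop : Continuous fun x : ℝ => (r ^ 2, x))
  have hD : ∀ x ∈ {x : ℝ | x ^ 2 ≤ r ^ 2}, r ^ 2 - x ^ 2 + b ^ 2 * x ^ 2 ≠ 0 :=
    fun x hx => (iso_D_pos hr hb hx).ne'
  have cγ : Continuous γ := by rw [hγ]; exact key _ hg₁
  have c3 := key _ hg₃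
  have cτ : ContinuousOn τ {x | x ^ 2 ≤ r ^ 2} := by
    rw [hτ]; unfold iso_tau
    fun_prop (disch := assumption)
  have cκ : ContinuousOn κ {x | x ^ 2 ≤ r ^ 2} := by
    rw [hκ]
    fun_prop
  have hk : ∀ x, x ^ 2 ≤ r ^ 2 → τ x * (r ^ 2 - x ^ 2) + b ^ 2 * x * κ x = g := by
    intro x hx
    have h1 : τ x * (r ^ 2 - x ^ 2 + b ^ 2 * x ^ 2) = g + b ^ 2 * g₃ (r ^ 2) x * x := by
      rw [hτ]; unfold iso_tau
      exact div_mul_cancel₀ _ (hD x hx)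
    simp only [hκ]
    linear_combination h1
  have hset : {y : E6 | (y 3)^2 + (y 4)^2 + (y 5)^2 = r ^ 2 ∧
      y 0 * y 3 + y 1 * y 4 + y 2 * y 5 = g ∧ H4 (b ^ 2) g₁ g₂ g₃ V y = h} =
      isoA r b g γ τ κ ρ := by
    ext y
    refine and_congr_right fun h1 => and_congr_right fun h2 => ?_
    have h5 : (y 5) ^ 2 ≤ r ^ 2 := by nlinarith [sq_nonneg (y 3), sq_nonneg (y 4)]
    rw [iso_H_eq b hb g₁ g₂ g₃ V y _ _ h1 h2 (hD _ h5)]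
    simp only [hγ, hτ, hκ, hρ]
    constructor <;> intro e <;> linarith
  have dΦ : ∀ x, x ^ 2 ≤ r ^ 2 → HasDerivAt ρ
      (-2 * fderiv ℝ (iso_Phi b g₁ g₂ g₃ V) (r ^ 2, g, x) (0, 0, 1)) x := by
    intro x hx
    have h1 := (iso_Phi_diff b g₁ g₂ g₃ V hg₁ hg₂ hg₃ hV (r ^ 2, g, x) (hD x hx)).hasFDerivAt
    have h2 : HasDerivAt (fun x : ℝ => (r ^ 2, g, x)) (0, 0, 1) x :=
      (hasDerivAt_const x _).prodMk ((hasDerivAt_const x _).prodMk (hasDerivAt_id x))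
    have h3 := ((h1.comp_hasDerivAt x h2).const_sub h).const_mul 2
    rw [hρ]
    rw [mul_neg, ← neg_mul] at h3
    exact h3
  have hR : iso_reg (fun z => ρ (iso_xi r b z)) := by
    constructor
    · intro z hz
      obtain ⟨d, _, hd⟩ := iso_xi_deriv hr hb hz
      exact ((dΦ _ (iso_xi_sq hb hz)).continuousAt.comp (f := iso_xi r b)
        hd.continuousAt).continuousWithinAt
    · intro z hz h0
      obtain ⟨d, hd0, hd⟩ := iso_xi_deriv hr hb hz
      have hx := iso_xi_sq (r := r) hb hz
      obtain ⟨x, hxx⟩ : ∃ x, x = iso_xi r b z := ⟨_, rfl⟩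
      have hx1 : z ^ 2 = 1 → x ^ 2 = r ^ 2 := by
        intro e
        rw [hxx, iso_xi, e, div_pow, mul_pow, e]
        simp
      replace h0 : ρ (iso_xi r b z) = 0 := h0
      rw [← hxx] at hx h0
      obtain ⟨s, hs⟩ : ∃ s : ℝ, s ^ 2 = r ^ 2 - x ^ 2 :=
        ⟨√(r ^ 2 - x ^ 2), Real.sq_sqrt (by linarith)⟩
      let y : E6 := ![τ x * s, γ x * s, b ^ 2 * κ x, s, 0, x]
      have y0 : y 0 = τ x * s := rfl
      have y1 : y 1 = γ x * s := rfl
      have y2 : y 2 = b ^ 2 * κ x := rfl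
      have y3 : y 3 = s := rfl
      have y4 : y 4 = 0 := rfl
      have y5 : y 5 = x := rfl
      have q1 : (y 3)^2 + (y 4)^2 + (y 5)^2 = r ^ 2 := by
        rw [y3, y4, y5]; linear_combination hs
      have q2 : y 0 * y 3 + y 1 * y 4 + y 2 * y 5 = g := by
        rw [y0, y1, y2, y3, y4, y5]; linear_combination hk x hx + τ x * hs
      have q3 : H4 (b ^ 2) g₁ g₂ g₃ V y = iso_Phi b g₁ g₂ g₃ V (r ^ 2, g, y 5) := by
        rw [iso_H_eq b hb g₁ g₂ g₃ V y _ _ q1 q2 (hD _ hx)]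
        rw [y0, y1, y2, y3, y4, y5]
        have t1 : iso_tau b g₃ (r ^ 2) g x = τ x := by rw [hτ]
        have t2 : g₁ (r ^ 2) x = γ x := by rw [hγ]
        have t3 : τ x * x - g₃ (r ^ 2) x = κ x := by rw [hκ]
        rw [t1, t2, t3, show b ^ 2 * κ x / b - b * κ x = 0 by field_simp; ring]
        ring
      have q4 : iso_Phi b g₁ g₂ g₃ V (r ^ 2, g, y 5) = h := by
        rw [hρ] at h0
        rw [y5]
        simp only at h0
        linarith
      have hc := iso_crit b hb g₁ g₂ g₃ V hg₁ hg₂ hg₃ hV y (r ^ 2) g q1 q2 (by positivity)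
        (iso_D_pos hr hb hx) q3 (hreg y q1 q2 (q3.trans q4))
      rw [y5] at hc
      refine ⟨?_, ?_, _, ?_, HasDerivAt.comp z (dΦ _ (iso_xi_sq hb hz)) hd⟩
      · rintro rfl; exact hc.2 (hx1 (by norm_num))
      · rintro rfl; exact hc.2 (hx1 (by norm_num))
      · rw [← hxx]
        exact mul_ne_zero (mul_ne_zero (by norm_num) hc.1) hd0
  obtain ⟨e⟩ := isoA_homeo r b g hr hb γ τ κ ρ cγ.continuousOn cτ cκ hk
  rw [hset]
  rcases isoX_model hR with ⟨⟨e2⟩⟩ | h2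
  · exact Or.inl ⟨e.trans e2⟩
  · exact Or.inr (iso_good_congr e h2)

end

/-- every regular isoenergy surface Q³ is homeomorphic to ℝP³ or to
a disjoint union of finitely many copies of S¹ × S² and at most two copies of S³. -/
theorem statement18 (β : ℝ) (hβ : 0 < β) (g₁ g₂ g₃ V : ℝ → ℝ → ℝ)
    (hg₁ : ContDiff ℝ (⊤ : ℕ∞) (Function.uncurry g₁))
    (hg₂ : ContDiff ℝ (⊤ : ℕ∞) (Function.uncurry g₂))
    (hg₃ : ContDiff ℝ (⊤ : ℕ∞) (Function.uncurry g₃))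
    (hV : ContDiff ℝ (⊤ : ℕ∞) (Function.uncurry V))
    (a g h : ℝ) (ha : 0 < a)
    (hreg : ∀ y : E6,
      (y 3)^2 + (y 4)^2 + (y 5)^2 = a →
      y 0 * y 3 + y 1 * y 4 + y 2 * y 5 = g →
      H4 β g₁ g₂ g₃ V y = h →
      LinearIndependent ℝ
        ![fderiv ℝ (H4 β g₁ g₂ g₃ V) y,
          fderiv ℝ (fun z : E6 => (z 3)^2 + (z 4)^2 + (z 5)^2) y,
          fderiv ℝ (fun z : E6 => z 0 * z 3 + z 1 * z 4 + z 2 * z 5) y]) :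
    let Q : Type := {y : E6 // (y 3)^2 + (y 4)^2 + (y 5)^2 = a ∧
      y 0 * y 3 + y 1 * y 4 + y 2 * y 5 = g ∧ H4 β g₁ g₂ g₃ V y = h}
    Nonempty (Q ≃ₜ RP3) ∨
    ∃ n m : ℕ, m ≤ 2 ∧
      Nonempty (Q ≃ₜ ((Σ _ : Fin n, sphereS 1 × sphereS 2) ⊕ (Σ _ : Fin m, sphereS 3))) := by
  intro Q
  obtain ⟨b, hb, rfl⟩ : ∃ b : ℝ, 0 < b ∧ b ^ 2 = β :=
    ⟨√β, Real.sqrt_pos.2 hβ, Real.sq_sqrt hβ.le⟩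
  obtain ⟨r, hr, rfl⟩ : ∃ r : ℝ, 0 < r ∧ r ^ 2 = a :=
    ⟨√a, Real.sqrt_pos.2 ha, Real.sq_sqrt ha.le⟩
  exact iso_final b r g h hb hr g₁ g₂ g₃ V hg₁ hg₂ hg₃ hV hreg

end
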